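/- arXiv:2010.07365 — 10 statements merged into one kernel-verified Lean document; each statement's English description precedes it below -/
import Mathlib

section
/- Let F be a field, A a finite-dimensional semisimple F-algebra, and B a finite-dimensional F-algebra that is central simple over F (its center is F and it is a simple ring). Let φ, φ' : A → B be F-algebra homomorphisms, and let B(φ) (resp. B(φ')) denote B regarded as a left A-module via a • b = φ(a)·b (resp. a • b = φ'(a)·b). If B(φ) and B(φ') are isomorphic as A-modules, then φ and φ' are conjugate by a unit of B: there exists a unit u ∈ Bˣ such that φ'(a) = u·φ(a)·u⁻¹ for all a ∈ A. -/
open TensorProduct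

theorem ns_density (F : Type*) [Field F] (D : Type*) [Ring D] [Algebra F D]
    [FiniteDimensional F D] [Algebra.IsCentral F D] [IsSimpleRing D] (g : D →ₗ[F] D) :
    ∃ t : D ⊗[F] Dᵐᵒᵖ, AlgHom.mulLeftRight F D t = g := by
  let _ : Module (D ⊗[F] Dᵐᵒᵖ) D := Module.compHom D (AlgHom.mulLeftRight F D).toRingHom
  have smul_def : ∀ (t : D ⊗[F] Dᵐᵒᵖ) (x : D), t • x = AlgHom.mulLeftRight F D t x :=
    fun _ _ => rfl
  have hs : IsSimpleModule (D ⊗[F] Dᵐᵒᵖ) D := by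
    rw [isSimpleModule_iff]
    refine { exists_pair_ne := ⟨⊥, ⊤, bot_ne_top⟩, eq_bot_or_eq_top := fun N => ?_ }
    let I : Ideal D :=
      { carrier := N
        add_mem' := fun ha hb => N.add_mem ha hb
        zero_mem' := N.zero_mem
        smul_mem' := fun c x hx => by
          have := N.smul_mem (c ⊗ₜ[F] (1 : Dᵐᵒᵖ)) hx
          rw [smul_def, AlgHom.mulLeftRight_apply] at this
          simpa using this }
    have hI : I.IsTwoSided := ⟨fun {a} b ha => by
      have := N.smul_mem ((1 : D) ⊗ₜ[F] (MulOpposite.op b)) ha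
      rw [smul_def, AlgHom.mulLeftRight_apply] at this
      have h2 : a * b ∈ N := by simpa using this
      exact h2⟩
    have hm : ∀ x, x ∈ I ↔ x ∈ N := fun x => Iff.rfl
    rcases (isSimpleRing_iff_isTwoSided_imp.mp (inferInstanceAs (IsSimpleRing D))).2 I hI with h | h
    · left; ext x; rw [← hm, h]; simp
    · right; ext x; rw [← hm, h]; simp
  have hcen : ∀ h : Module.End (D ⊗[F] Dᵐᵒᵖ) D, ∃ k : F, ∀ x, h x = k • x := by
    intro h
    have hl : ∀ x, h x = x * h 1 := fun x => by
      have := h.map_smul (x ⊗ₜ[F] (1 : Dᵐᵒᵖ)) 1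
      rw [smul_def, smul_def, AlgHom.mulLeftRight_apply, AlgHom.mulLeftRight_apply] at this
      simpa using this
    have hr : ∀ x, h x = h 1 * x := fun x => by
      have := h.map_smul ((1 : D) ⊗ₜ[F] (MulOpposite.op x)) 1
      rw [smul_def, smul_def, AlgHom.mulLeftRight_apply, AlgHom.mulLeftRight_apply] at this
      simpa using this
    have hc : h 1 ∈ Subalgebra.center F D := by
      rw [Subalgebra.mem_center_iff]
      intro b
      rw [← hl, ← hr]
    obtain ⟨k, hk⟩ := Algebra.mem_bot.mp (Algebra.IsCentral.out hc)
    exact ⟨k, fun x => by rw [hr, ← hk, Algebra.smul_def]⟩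
  let f : Module.End (Module.End (D ⊗[F] Dᵐᵒᵖ) D) D :=
    { toFun := g
      map_add' := g.map_add
      map_smul' := fun h x => by
        obtain ⟨k, hk⟩ := hcen h
        simp [hk] }
  classical
  let b := Module.finBasis F D
  obtain ⟨r, hr⟩ := jacobson_density f (Finset.univ.image b)
  refine ⟨r, b.ext fun i => ?_⟩
  exact (hr (b i) (by simp)).symm

theorem ns_simple (F : Type*) [Field F] (C D : Type*) [Ring C] [Algebra F C] [IsSimpleRing C]
    [Ring D] [Algebra F D]
    [FiniteDimensional F D] [Algebra.IsCentral F D] [IsSimpleRing D] :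
    IsSimpleRing (C ⊗[F] D) := by
  rw [isSimpleRing_iff_isTwoSided_imp]
  refine ⟨inferInstance, fun I hI => ?_⟩
  by_contra! hne
  obtain ⟨hb, ht⟩ := hne
  obtain ⟨x, hx, hx0⟩ := Submodule.exists_mem_ne_zero_of_ne_bot hb
  have hop : ∀ t : D ⊗[F] Dᵐᵒᵖ, ∀ y ∈ I, (AlgHom.mulLeftRight F D t).lTensor C y ∈ I := by
    intro t y hy
    induction t with
    | zero => simp
    | add t s h1 h2 => simpa [LinearMap.lTensor_add] using I.add_mem h1 h2
    | tmul p q =>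
      have : ∀ z, (AlgHom.mulLeftRight F D (p ⊗ₜ q)).lTensor C z
          = ((1 : C) ⊗ₜ[F] p) * z * ((1 : C) ⊗ₜ[F] q.unop) := by
        intro z
        induction z with
        | zero => simp
        | add y z h1 h2 => rw [map_add, h1, h2, mul_add, add_mul]
        | tmul c d => simp
      rw [this]
      exact I.mul_mem_right _ (I.mul_mem_left _ hy)
  let b := Module.finBasis F D
  obtain ⟨c, hc⟩ := TensorProduct.eq_repr_basis_right b x
  have hci : ∀ i, c i ⊗ₜ[F] (1 : D) ∈ I := by
    intro i
    obtain ⟨t, htt⟩ := ns_density F D ((b.coord i).smulRight (1 : D))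
    have := hop t x hx
    rw [htt, ← hc, Finsupp.sum_fintype _ _ (by simp)] at this
    simpa [Finsupp.single_apply, ite_smul, TensorProduct.tmul_ite] using this
  let J : Ideal C := I.comap (Algebra.TensorProduct.includeLeft : C →ₐ[F] C ⊗[F] D)
  have hJ : J.IsTwoSided := inferInstance
  rcases (isSimpleRing_iff_isTwoSided_imp.mp (inferInstanceAs (IsSimpleRing C))).2 J hJ with h | h
  · apply hx0
    have : c = 0 := by
      ext i
      have : c i ∈ J := hci i
      rw [h] at this
      simpa using this
    rw [← hc, this]; simp
  · apply ht
    rw [Ideal.eq_top_iff_one] at h ⊢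
    exact h

theorem ns_mod.{v} (F : Type*) [Field F] (R : Type*) [Ring R] [Algebra F R] [IsSimpleRing R]
    [FiniteDimensional F R] (V W : Type v) [AddCommGroup V] [AddCommGroup W] [Module F V]
    [Module F W] [FiniteDimensional F V] [FiniteDimensional F W]
    (ρ : R →ₐ[F] Module.End F V) (σ : R →ₐ[F] Module.End F W)
    (h : Module.finrank F V = Module.finrank F W) :
    ∃ f : V ≃+ W, ∀ r v, f (ρ r v) = σ r (f v) := by
  let _ : Module R V := Module.compHom V ρ.toRingHom
  let _ : Module R W := Module.compHom W σ.toRingHom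
  have hV : ∀ (r : R) (v : V), r • v = ρ r v := fun _ _ => rfl
  have hW : ∀ (r : R) (v : W), r • v = σ r v := fun _ _ => rfl
  have : IsScalarTower F R V := ⟨fun a r v => by simp [hV]⟩
  have : IsScalarTower F R W := ⟨fun a r v => by simp [hW]⟩
  have : IsArtinianRing R := IsArtinianRing.of_finite F R
  have : Module.Finite R V := Module.Finite.of_restrictScalars_finite F R V
  have : Module.Finite R W := Module.Finite.of_restrictScalars_finite F R W
  obtain ⟨S, hS⟩ := IsAtomic.exists_atom (Submodule R R) 
  rw [← isSimpleModule_iff_isAtom] at hS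
  have key : ∀ (X : Type v) [AddCommGroup X] [Module R X], IsIsotypicOfType R X S := by
    intro X _ _ m hm
    obtain ⟨J, ⟨e⟩⟩ := IsSemisimpleRing.exists_linearEquiv_ideal_of_isSimpleModule R m
    have := IsSimpleModule.congr e.symm
    exact ⟨e.trans (IsSimpleRing.isIsotypic R R S J).some⟩
  obtain ⟨m, ⟨e1⟩⟩ := (key V).linearEquiv_fun
  obtain ⟨n, ⟨e2⟩⟩ := (key W).linearEquiv_fun
  have h1 := (e1.restrictScalars F).finrank_eq
  have h2 := (e2.restrictScalars F).finrank_eq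
  have : FiniteDimensional F S := FiniteDimensional.finiteDimensional_submodule (S.restrictScalars F)
  have := IsSimpleModule.nontrivial R S
  have hpos : 0 < Module.finrank F S := Module.finrank_pos
  rw [Module.finrank_pi_fintype] at h1 h2
  simp at h1 h2
  have : m = n := by
    rw [h1, h2] at h
    exact Nat.eq_of_mul_eq_mul_right hpos h
  subst this
  exact ⟨(e1.trans e2.symm).toAddEquiv, fun r v => (e1.trans e2.symm).map_smul r v⟩

/-- The subspace on which `p` acts as the identity from the left. -/
def nsFix (F : Type*) [Field F] {B : Type*} [Ring B] [Algebra F B] (p : B) : Submodule F B where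
  carrier := {x | p * x = x}
  add_mem' := fun {a b} (ha : p * a = a) (hb : p * b = b) => by
    change p * (a + b) = a + b
    rw [mul_add, ha, hb]
  zero_mem' := mul_zero p
  smul_mem' := fun c x (hx : p * x = x) => by
    change p * (c • x) = c • x
    rw [mul_smul_comm, hx]

theorem mem_nsFix {F : Type*} [Field F] {B : Type*} [Ring B] [Algebra F B] {p x : B} :
    x ∈ nsFix F p ↔ p * x = x := Iff.rfl

theorem ns_rep (F : Type*) [Field F] (C B : Type*) [Ring C] [Algebra F C] [Ring B] [Algebra F B]
    (ψ : C →ₗ[F] B) (hψ : ∀ a b, ψ (a * b) = ψ a * ψ b) :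
    ∃ ρ : C ⊗[F] Bᵐᵒᵖ →ₐ[F] Module.End F (nsFix F (ψ 1)),
      ∀ c b v, (ρ (c ⊗ₜ b) v : B) = ψ c * v * b.unop := by
  let l : C →ₐ[F] Module.End F (nsFix F (ψ 1)) := AlgHom.ofLinearMap
    { toFun := fun c => (LinearMap.mulLeft F (ψ c)).restrict (fun x hx => by
        rw [mem_nsFix] at hx ⊢
        rw [LinearMap.mulLeft_apply, ← mul_assoc, ← hψ, one_mul])
      map_add' := fun a b => by ext x; simp [add_mul]
      map_smul' := fun a b => by ext x; simp }
    (by ext x; exact x.2)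
    (fun a b => by ext x; simp [hψ, mul_assoc])
  let r : Bᵐᵒᵖ →ₐ[F] Module.End F (nsFix F (ψ 1)) := AlgHom.ofLinearMap
    { toFun := fun c => (LinearMap.mulRight F c.unop).restrict (fun x hx => by
        rw [mem_nsFix] at hx ⊢
        rw [LinearMap.mulRight_apply, ← mul_assoc, hx])
      map_add' := fun a b => by ext x; simp [mul_add]
      map_smul' := fun a b => by ext x; simp }
    (by ext x; simp)
    (fun a b => by ext x; simp [mul_assoc])
  have hl : ∀ c x, (l c x : B) = ψ c * x := fun _ _ => rfl
  have hr : ∀ c x, (r c x : B) = x * c.unop := fun _ _ => rfl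
  clear_value l r
  have hcomm : ∀ c b, Commute (l c) (r b) := fun c b => by
    apply LinearMap.ext
    intro x
    apply Subtype.ext
    simp only [Module.End.mul_apply, hl, hr, mul_assoc]
  refine ⟨Algebra.TensorProduct.lift l r hcomm, fun c b v => ?_⟩
  have key := Algebra.TensorProduct.lift_tmul l r hcomm c b
  have key2 := congrArg (fun g : Module.End F (nsFix F (ψ 1)) => ((g v : nsFix F (ψ 1)) : B)) key
  refine key2.trans ?_
  simp only [Module.End.mul_apply, hl, hr, mul_assoc]

theorem ns_block (F : Type*) [Field F] (C B : Type*) [Ring C] [Algebra F C] [Ring B] [Algebra F B]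
    [FiniteDimensional F C] [IsSimpleRing C]
    [FiniteDimensional F B] [Algebra.IsCentral F B] [IsSimpleRing B]
    (ψ ψ' : C →ₗ[F] B) (hψ : ∀ a b, ψ (a * b) = ψ a * ψ b)
    (hψ' : ∀ a b, ψ' (a * b) = ψ' a * ψ' b)
    (h : Module.finrank F (nsFix F (ψ 1)) = Module.finrank F (nsFix F (ψ' 1))) :
    ∃ v w : B, (∀ c, v * ψ c = ψ' c * v) ∧ v * w = ψ' 1 ∧ w * v = ψ 1 ∧
      ψ' 1 * v = v ∧ ψ 1 * w = w := by
  obtain ⟨ρ, hρ⟩ := ns_rep F C B ψ hψ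
  obtain ⟨σ, hσ⟩ := ns_rep F C B ψ' hψ'
  have := ns_simple F C Bᵐᵒᵖ
  obtain ⟨f, hf⟩ := ns_mod F (C ⊗[F] Bᵐᵒᵖ) _ _ ρ σ h
  have hf' : ∀ r x, f.symm (σ r x) = ρ r (f.symm x) := fun r x => by
    rw [AddEquiv.symm_apply_eq, hf, AddEquiv.apply_symm_apply]
  have h1 : ψ 1 * ψ 1 = ψ 1 := by rw [← hψ, one_mul]
  have h1' : ψ' 1 * ψ' 1 = ψ' 1 := by rw [← hψ', one_mul]
  let p : nsFix F (ψ 1) := ⟨ψ 1, h1⟩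
  let p' : nsFix F (ψ' 1) := ⟨ψ' 1, h1'⟩
  have A1 : ∀ x : nsFix F (ψ 1), (f p : B) * x = f x := fun x => by
    have := congrArg Subtype.val (hf (1 ⊗ₜ MulOpposite.op (x : B)) p)
    rw [hσ] at this
    have e : ρ (1 ⊗ₜ MulOpposite.op (x : B)) p = x := by
      ext; rw [hρ]; simp only [p, h1, MulOpposite.unop_op]; exact x.2
    rw [e] at this
    rw [this, (f p).2, MulOpposite.unop_op]
  have A2 : ∀ x : nsFix F (ψ' 1), (f.symm p' : B) * x = f.symm x := fun x => by
    have := congrArg Subtype.val (hf' (1 ⊗ₜ MulOpposite.op (x : B)) p')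
    rw [hρ] at this
    have e : σ (1 ⊗ₜ MulOpposite.op (x : B)) p' = x := by
      ext; rw [hσ]; simp only [p', h1', MulOpposite.unop_op]; exact x.2
    rw [e] at this
    rw [this, (f.symm p').2, MulOpposite.unop_op]
  refine ⟨f p, f.symm p', fun c => ?_, ?_, ?_, (f p).2, (f.symm p').2⟩
  · have hc : ψ c ∈ nsFix F (ψ 1) := by rw [mem_nsFix, ← hψ, one_mul]
    have := congrArg Subtype.val (hf (c ⊗ₜ 1) p)
    rw [hσ, MulOpposite.unop_one, mul_one] at this
    rw [← this, A1 ⟨ψ c, hc⟩]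
    congr 2
    ext
    rw [hρ]
    simp [p, ← hψ]
  · rw [A1, AddEquiv.apply_symm_apply]
  · rw [A2, AddEquiv.symm_apply_apply]

/-- **Noether–Skolem plus epsilon.**  Let `F` be a field, `A` a finite-dimensional
semisimple `F`-algebra and `B` a finite-dimensional central simple `F`-algebra.
If `φ, φ' : A → B` are `F`-algebra homomorphisms such that `B` with the left
`A`-module structure `a • b = φ a * b` is isomorphic to `B` with the left
`A`-module structure `a • b = φ' a * b`, then `φ` and `φ'` are conjugate by a
unit of `B`. -/
theorem noether_skolem_plus_epsilon
    (F : Type*) [Field F] (A B : Type*) [Ring A] [Ring B] [Algebra F A] [Algebra F B]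
    [FiniteDimensional F A] [FiniteDimensional F B]
    [IsSemisimpleRing A] [Algebra.IsCentral F B] [IsSimpleRing B]
    (φ φ' : A →ₐ[F] B)
    (e : B ≃+ B) (he : ∀ (a : A) (b : B), e (φ a * b) = φ' a * e b) :
    ∃ u : Bˣ, ∀ a : A, φ' a = (u : B) * φ a * ((u⁻¹ : Bˣ) : B) := by
  obtain ⟨n, D, d, _, _, _, _, ⟨E⟩⟩ :=
    IsSemisimpleRing.exists_algEquiv_pi_matrix_divisionRing_finite F A
  let ι : ∀ i, Matrix (Fin (d i)) (Fin (d i)) (D i) →ₗ[F] A := fun i =>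
    E.symm.toLinearMap ∘ₗ LinearMap.single F (fun i => Matrix (Fin (d i)) (Fin (d i)) (D i)) i
  have ιdef : ∀ i x, ι i x = E.symm (Pi.single i x) := fun _ _ => rfl
  have hι : ∀ i x y, ι i (x * y) = ι i x * ι i y := fun i x y => by
    rw [ιdef, ιdef, ιdef, ← map_mul, Pi.single_mul]
  have hιo : ∀ i j, i ≠ j → ι i 1 * ι j 1 = 0 := fun i j hij => by
    rw [ιdef, ιdef, ← map_mul]
    have : (Pi.single i 1 * Pi.single j 1 :
      ∀ i, Matrix (Fin (d i)) (Fin (d i)) (D i)) = 0 := by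
      ext k : 1
      by_cases h : k = i
      · subst h; simp [Pi.single_eq_of_ne hij]
      · simp [Pi.single_eq_of_ne h]
    rw [this, map_zero]
  have hιs : ∀ a, a = ∑ i, ι i (E a i) := fun a => by
    simp only [ιdef]
    rw [← map_sum, Finset.univ_sum_single, AlgEquiv.symm_apply_apply]
  have hι1 : ∑ i, ι i 1 = 1 := by
    conv_rhs => rw [hιs 1]
    simp
  let eL : B ≃ₗ[F] B := { e with
    map_smul' := fun c x => by
      have := he (algebraMap F A c) x
      simpa [Algebra.smul_def] using this }
  have heL : ∀ x, eL x = e x := fun _ => rfl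
  have hrank : ∀ i, Module.finrank F (nsFix F (φ (ι i 1))) =
      Module.finrank F (nsFix F (φ' (ι i 1))) := fun i => by
    rw [← LinearEquiv.finrank_map_eq eL]
    suffices hm : Submodule.map (eL : B →ₗ[F] B) (nsFix F (φ (ι i 1))) = nsFix F (φ' (ι i 1)) by
      rw [hm]
    ext y
    rw [Submodule.mem_map_equiv, mem_nsFix, mem_nsFix, ← eL.injective.eq_iff, heL, he, ← heL,
      LinearEquiv.apply_symm_apply]
  have hb := fun i => ns_block F (Matrix (Fin (d i)) (Fin (d i)) (D i)) B
    (φ.toLinearMap ∘ₗ ι i) (φ'.toLinearMap ∘ₗ ι i)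
    (fun a b => by simp [hι]) (fun a b => by simp [hι]) (hrank i)
  simp only [LinearMap.comp_apply, AlgHom.toLinearMap_apply] at hb
  choose v w h1 h2 h3 h4 h5 using hb
  have vw : (∑ i, v i) * (∑ i, w i) = 1 := by
    rw [Finset.sum_mul_sum, ← map_one φ', ← hι1, map_sum]
    refine Finset.sum_congr rfl fun i _ => ?_
    rw [Finset.sum_eq_single i _ (by simp), h2]
    intro j _ hj
    rw [← h5 j, ← h4 i, ← h1, mul_assoc, ← mul_assoc (φ _), ← map_mul, hιo i j hj.symm]
    simp
  have : IsArtinianRing B := IsArtinianRing.of_finite F B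
  have : IsNoetherianRing B := inferInstance
  have wv : (∑ i, w i) * (∑ i, v i) = 1 := mul_eq_one_comm.mp vw
  have hcomm : ∀ a, (∑ i, v i) * φ a = φ' a * ∑ i, v i := fun a => by
    have L : ∀ i, v i * φ a = v i * φ (ι i (E a i)) := fun i => by
      have hz : ι i 1 * a = ι i (E a i) := by
        apply E.injective
        rw [map_mul, ιdef, ιdef]
        simp only [AlgEquiv.apply_symm_apply]
        ext k : 1
        by_cases h : k = i
        · subst h; simp
        · simp [Pi.single_eq_of_ne h]
      rw [← hz, map_mul, ← mul_assoc, h1, h4]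
    have R : ∀ i, φ' a * v i = φ' (ι i (E a i)) * v i := fun i => by
      have hz : a * ι i 1 = ι i (E a i) := by
        apply E.injective
        rw [map_mul, ιdef, ιdef]
        simp only [AlgEquiv.apply_symm_apply]
        ext k : 1
        by_cases h : k = i
        · subst h; simp
        · simp [Pi.single_eq_of_ne h]
      rw [← hz, map_mul, mul_assoc, h4]
    rw [Finset.sum_mul, Finset.mul_sum]
    exact Finset.sum_congr rfl fun i _ => by rw [L, R, h1]
  refine ⟨⟨_, _, vw, wv⟩, fun a => ?_⟩
  change φ' a = (∑ i, v i) * φ a * (∑ i, w i)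
  rw [hcomm, mul_assoc, vw, mul_one]
end

section
/- Let F be a field, B a finite-dimensional central simple F-algebra, and L a finite étale commutative F-algebra. Let ι, ι' : L → B be two F-algebra embeddings, i.e. injective F-algebra homomorphisms such that B is free as an L-module when L acts through ι and also when L acts through ι'. Then ι and ι' are conjugate by a unit of B: there exists u ∈ Bˣ with ι'(x) = u·ι(x)·u⁻¹ for all x ∈ L. -/
universe u
open TensorProduct

theorem aux_mulLeftRight_surj (F A : Type*) [Field F] [Ring A] [Algebra F A]
    [FiniteDimensional F A] [Algebra.IsCentral F A] [IsSimpleRing A] :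
    Function.Surjective (AlgHom.mulLeftRight F A) := by
  let _ : Module (A ⊗[F] Aᵐᵒᵖ) A := Module.compHom A (AlgHom.mulLeftRight F A).toRingHom
  have hsmul : ∀ (r : A ⊗[F] Aᵐᵒᵖ) (x : A), r • x = AlgHom.mulLeftRight F A r x :=
    fun _ _ => rfl
  have hs : ∀ (a b x : A), (a ⊗ₜ[F] MulOpposite.op b : A ⊗[F] Aᵐᵒᵖ) • x = a * x * b := by
    intro a b x; rw [hsmul]; simp
  have hsimple : IsSimpleModule (A ⊗[F] Aᵐᵒᵖ) A := by
    obtain ⟨_, h⟩ := isSimpleRing_iff_isTwoSided_imp.mp (inferInstance : IsSimpleRing A)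
    rw [isSimpleModule_iff]
    refine { exists_pair_ne := exists_pair_ne _, eq_bot_or_eq_top := ?_ }
    intro P
    let I : Ideal A :=
      { carrier := P
        add_mem' := P.add_mem
        zero_mem' := P.zero_mem
        smul_mem' := by
          intro c x hx
          have := P.smul_mem (c ⊗ₜ[F] MulOpposite.op 1) hx
          rw [hs, mul_one] at this
          exact this }
    have hI : I.IsTwoSided := ⟨by
      intro a b ha
      have := P.smul_mem (1 ⊗ₜ[F] MulOpposite.op b) ha
      rw [hs, one_mul] at this
      exact this⟩
    rcases h I hI with h | h
    · left
      ext x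
      have : x ∈ I ↔ x ∈ (⊥ : Ideal A) := by rw [h]
      exact this
    · right
      ext x
      have : x ∈ I ↔ x ∈ (⊤ : Ideal A) := by rw [h]
      exact this
  intro f
  have key : ∀ g : Module.End (A ⊗[F] Aᵐᵒᵖ) A, ∃ c : F, ∀ x, g x = c • x := by
    intro g
    have h1 : ∀ x, g x = x * g 1 := by
      intro x
      have := g.map_smul (x ⊗ₜ[F] MulOpposite.op 1) 1
      rw [hs, hs, mul_one, mul_one, mul_one] at this
      exact this
    have h2 : ∀ x, g x = g 1 * x := by
      intro x
      have := g.map_smul (1 ⊗ₜ[F] MulOpposite.op x) 1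
      rw [hs, hs, one_mul, one_mul, one_mul] at this
      exact this
    have : g 1 ∈ Subalgebra.center F A := by
      rw [Subalgebra.mem_center_iff]
      intro b
      rw [← h1, h2]
    rw [Algebra.IsCentral.mem_center_iff] at this
    obtain ⟨c, hc⟩ := this
    refine ⟨c, fun x => ?_⟩
    rw [h2, hc, Algebra.smul_def]
  let f' : Module.End (Module.End (A ⊗[F] Aᵐᵒᵖ) A) A :=
    { toFun := f
      map_add' := map_add f
      map_smul' := by
        intro g x
        obtain ⟨c, hc⟩ := key g
        simp only [Module.End.smul_def, hc, RingHom.id_apply, map_smul] }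
  obtain ⟨s, hs'⟩ := (Module.Finite.fg_top : (⊤ : Submodule F A).FG)
  obtain ⟨r, hr⟩ := jacobson_density f' s
  refine ⟨r, ?_⟩
  apply LinearMap.ext_on (s := (s : Set A)) hs'
  intro x hx
  exact (hr x hx).symm

theorem aux_simple (F K A : Type*) [Field F] [Field K] [Algebra F K] [Ring A] [Algebra F A]
    [FiniteDimensional F A] [Algebra.IsCentral F A] [IsSimpleRing A] :
    IsSimpleRing (K ⊗[F] A) := by
  rw [isSimpleRing_iff_isTwoSided_imp]
  refine ⟨inferInstance, fun I hI => ?_⟩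
  have stab : ∀ (f : Module.End F A) (x : K ⊗[F] A), x ∈ I → LinearMap.lTensor K f x ∈ I := by
    intro f x hx
    obtain ⟨t, rfl⟩ := aux_mulLeftRight_surj F A f
    induction t with
    | zero => simp
    | add a b ha hb =>
      rw [map_add, LinearMap.lTensor_add, LinearMap.add_apply]
      exact I.add_mem ha hb
    | tmul a b =>
      have : LinearMap.lTensor K (AlgHom.mulLeftRight F A (a ⊗ₜ b)) x
          = (1 ⊗ₜ a) * x * (1 ⊗ₜ b.unop) := by
        clear hx
        induction x with
        | zero => simp
        | add x y hx hy => rw [map_add, hx, hy, mul_add, add_mul]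
        | tmul k y => simp
      rw [this]
      exact I.mul_mem_right _ (I.mul_mem_left _ hx)
  by_cases h : I = ⊥
  · exact Or.inl h
  right
  obtain ⟨x, hx, hx0⟩ := Submodule.exists_mem_ne_zero_of_ne_bot h
  let b := Module.finBasis F A
  let b' := Algebra.TensorProduct.basis K b
  obtain ⟨j, hj⟩ : ∃ j, b'.repr x j ≠ 0 := by
    by_contra! hc
    exact hx0 (b'.repr.injective (by ext j; simpa using hc j))
  have h2 : LinearMap.lTensor K ((b.coord j).smulRight (1 : A)) x = (b'.repr x j) ⊗ₜ 1 := by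
    clear hj hx hx0
    induction x with
    | zero => simp
    | add x y hx hy => simp [hx, hy, add_tmul]
    | tmul k y => 
      simp only [b', LinearMap.lTensor_tmul, LinearMap.smulRight_apply, Module.Basis.coord_apply,
        Algebra.TensorProduct.basis_repr_tmul, TensorProduct.tmul_smul, TensorProduct.smul_tmul']
      congr 1
      simp [Algebra.smul_def, mul_comm]
  have h3 := stab ((b.coord j).smulRight (1 : A)) x hx
  rw [h2] at h3
  rw [Ideal.eq_top_iff_one]
  have := I.mul_mem_left ((b'.repr x j)⁻¹ ⊗ₜ 1) h3
  simpa [inv_mul_cancel₀ hj, Algebra.TensorProduct.one_def] using this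

theorem aux_modules (F R : Type*) [Field F] [Ring R] [Algebra F R] [IsSimpleRing R]
    [IsArtinianRing R] (N N' : Type u) [AddCommGroup N] [AddCommGroup N'] [Module F N]
    [Module F N'] [Module R N] [Module R N'] [IsScalarTower F R N] [IsScalarTower F R N']
    [FiniteDimensional F N] [FiniteDimensional F N']
    (h : Module.finrank F N = Module.finrank F N') : Nonempty (N ≃ₗ[R] N') := by
  have : Module.Finite R N := Module.Finite.of_restrictScalars_finite F R N
  have : Module.Finite R N' := Module.Finite.of_restrictScalars_finite F R N'
  rcases subsingleton_or_nontrivial N with hN | hN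
  · have : Module.finrank F N' = 0 := by rw [← h]; exact Module.finrank_zero_of_subsingleton
    have : Subsingleton N' := Module.finrank_zero_iff.mp this
    exact ⟨0⟩
  have hprod := IsSimpleRing.isIsotypic R (N × N')
  obtain ⟨n, _, S, hS, ⟨e⟩⟩ := (IsSimpleRing.isIsotypic R N).linearEquiv_fun
  let T := S.map (LinearMap.inl R N N')
  have eT : S ≃ₗ[R] T := S.equivMapOfInjective (LinearMap.inl R N N') LinearMap.inl_injective
  have hT : IsSimpleModule R T := IsSimpleModule.congr eT.symm
  have h' : IsIsotypicOfType R N' T := (hprod T).of_injective (LinearMap.inr R N N') LinearMap.inr_injective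
  obtain ⟨m, ⟨e'⟩⟩ := (h'.of_linearEquiv_type eT.symm).linearEquiv_fun
  have : Module.Finite F S :=
    Module.Finite.of_injective (S.subtype.restrictScalars F) S.subtype_injective
  have d1 : Module.finrank F N = n * Module.finrank F S := by
    rw [(e.restrictScalars F).finrank_eq, Module.finrank_pi_fintype]; simp
  have d2 : Module.finrank F N' = m * Module.finrank F S := by
    rw [(e'.restrictScalars F).finrank_eq, Module.finrank_pi_fintype]; simp
  have hpos : 0 < Module.finrank F N := Module.finrank_pos
  have : n = m := by
    rw [d1, d2] at h
    rw [d1] at hpos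
    exact Nat.eq_of_mul_eq_mul_right (Nat.pos_of_mul_pos_left hpos) h
  subst this
  exact ⟨e.trans e'.symm⟩

theorem aux_bimod (F K A : Type*) [Field F] [Field K] [Algebra F K] [FiniteDimensional F K]
    [Ring A] [Algebra F A]
    [FiniteDimensional F A] [Algebra.IsCentral F A] [IsSimpleRing A]
    (N N' : Type u) [AddCommGroup N] [AddCommGroup N'] [Module F N]
    [Module F N'] [Module K N] [Module K N'] [IsScalarTower F K N] [IsScalarTower F K N']
    [Module A N] [Module A N'] [IsScalarTower F A N] [IsScalarTower F A N']
    [SMulCommClass K A N] [SMulCommClass K A N']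
    [FiniteDimensional F N] [FiniteDimensional F N']
    (h : Module.finrank F N = Module.finrank F N') :
    ∃ e : N ≃+ N', (∀ (k : K) x, e (k • x) = k • e x) ∧ ∀ (a : A) x, e (a • x) = a • e x := by
  let _ : Module (K ⊗[F] A) N := TensorProduct.Algebra.module
  let _ : Module (K ⊗[F] A) N' := TensorProduct.Algebra.module
  have t1 : IsScalarTower F (K ⊗[F] A) N := ⟨fun r ab a => by
      change TensorProduct.Algebra.moduleAux _ _ = _ • TensorProduct.Algebra.moduleAux _ _
      simp⟩
  have t2 : IsScalarTower F (K ⊗[F] A) N' := ⟨fun r ab a => by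
      change TensorProduct.Algebra.moduleAux _ _ = _ • TensorProduct.Algebra.moduleAux _ _
      simp⟩
  have := aux_simple F K A
  have : IsArtinianRing (K ⊗[F] A) := IsArtinianRing.of_finite F _
  obtain ⟨e⟩ := aux_modules F (K ⊗[F] A) N N' h
  refine ⟨e.toAddEquiv, fun k x => ?_, fun a x => ?_⟩
  · have := e.map_smul (k ⊗ₜ 1) x
    simpa [TensorProduct.Algebra.smul_def] using this
  · have := e.map_smul (1 ⊗ₜ a) x
    simpa [TensorProduct.Algebra.smul_def] using this

/-- The right ideal `{b | f 1 * b = b}` attached to a non-unital homomorphism `f : K → B`. -/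
def auxIdeal {F K B : Type*} [Field F] [Field K] [Algebra F K] [Ring B] [Algebra F B]
    (f : K →ₙₐ[F] B) : Submodule Bᵐᵒᵖ B where
  carrier := {b | f 1 * b = b}
  add_mem' := by
    intro a b (ha : _ = _) (hb : _ = _)
    change _ = _
    rw [mul_add, ha, hb]
  zero_mem' := by simp
  smul_mem' := by
    intro c x (hx : _ = _)
    change f 1 * (x * c.unop) = x * c.unop
    rw [← mul_assoc, hx]

theorem mem_auxIdeal {F K B : Type*} [Field F] [Field K] [Algebra F K] [Ring B] [Algebra F B]
    (f : K →ₙₐ[F] B) (b : B) : b ∈ auxIdeal f ↔ f 1 * b = b := Iff.rfl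

theorem aux_mul_mem {F K B : Type*} [Field F] [Field K] [Algebra F K] [Ring B] [Algebra F B]
    (f : K →ₙₐ[F] B) (k : K) (b : B) : f k * b ∈ auxIdeal f := by
  rw [mem_auxIdeal, ← mul_assoc, ← map_mul, one_mul]

/-- The `K`-module structure on the right ideal attached to `f`. -/
@[reducible] def auxModule {F K B : Type*} [Field F] [Field K] [Algebra F K] [Ring B] [Algebra F B]
    (f : K →ₙₐ[F] B) : Module K (auxIdeal f) where
  smul k b := ⟨f k * b, aux_mul_mem f k b⟩
  one_smul b := Subtype.ext b.2
  mul_smul k l b := Subtype.ext (by change f (k * l) * b = f k * (f l * b); rw [map_mul, mul_assoc])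
  smul_zero k := Subtype.ext (by change f k * 0 = 0; simp)
  smul_add k a b := Subtype.ext (by change f k * (a + b) = f k * a + f k * b; rw [mul_add])
  add_smul k l b := Subtype.ext (by change f (k + l) * b = f k * b + f l * b; rw [map_add, add_mul])
  zero_smul b := Subtype.ext (by change f 0 * b = 0; simp)

theorem aux_local {F K B : Type u} [Field F] [Field K] [Algebra F K] [FiniteDimensional F K]
    [Ring B] [Algebra F B] [FiniteDimensional F B] [Algebra.IsCentral F B] [IsSimpleRing B]
    (f f' : K →ₙₐ[F] B)
    (h : Module.finrank F (auxIdeal f) = Module.finrank F (auxIdeal f')) :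
    ∃ u v : B, (∀ k, u * f k = f' k * u) ∧ (∀ k, v * f' k = f k * v) ∧ v * u = f 1 ∧
      u * v = f' 1 ∧ f' 1 * u = u ∧ f 1 * v = v := by
  let _ := auxModule f
  let _ := auxModule f'
  have hs : ∀ (k : K) (x : auxIdeal f), ((k • x : auxIdeal f) : B) = f k * x := fun _ _ => rfl
  have hs' : ∀ (k : K) (x : auxIdeal f'), ((k • x : auxIdeal f') : B) = f' k * x := fun _ _ => rfl
  have : IsScalarTower F K (auxIdeal f) := ⟨fun c k x => Subtype.ext (by
    rw [hs, map_smul, Submodule.coe_smul_of_tower, hs, smul_mul_assoc])⟩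
  have : IsScalarTower F K (auxIdeal f') := ⟨fun c k x => Subtype.ext (by
    rw [hs', map_smul, Submodule.coe_smul_of_tower, hs', smul_mul_assoc])⟩
  have : SMulCommClass K Bᵐᵒᵖ (auxIdeal f) := ⟨fun k c x => Subtype.ext (by
    rw [hs, Submodule.coe_smul, Submodule.coe_smul, hs, mul_smul_comm])⟩
  have : SMulCommClass K Bᵐᵒᵖ (auxIdeal f') := ⟨fun k c x => Subtype.ext (by
    rw [hs', Submodule.coe_smul, Submodule.coe_smul, hs', mul_smul_comm])⟩
  have : FiniteDimensional F (auxIdeal f) :=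
    Module.Finite.of_injective ((auxIdeal f).subtype.restrictScalars F) Subtype.val_injective
  have : FiniteDimensional F (auxIdeal f') :=
    Module.Finite.of_injective ((auxIdeal f').subtype.restrictScalars F) Subtype.val_injective
  obtain ⟨e, he1, he2⟩ := aux_bimod F K Bᵐᵒᵖ (auxIdeal f) (auxIdeal f') h
  have hi1 : ∀ (k : K) x, e.symm (k • x) = k • e.symm x := fun k x => by
    rw [AddEquiv.symm_apply_eq, he1, AddEquiv.apply_symm_apply]
  have hi2 : ∀ (k : Bᵐᵒᵖ) x, e.symm (k • x) = k • e.symm x := fun k x => by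
    rw [AddEquiv.symm_apply_eq, he2, AddEquiv.apply_symm_apply]
  let i : auxIdeal f := ⟨f 1, by rw [mem_auxIdeal, ← map_mul, one_mul]⟩
  let i' : auxIdeal f' := ⟨f' 1, by rw [mem_auxIdeal, ← map_mul, one_mul]⟩
  have c1 : ∀ k, MulOpposite.op (f k) • i = k • i := fun k => Subtype.ext (by
    rw [hs]; change f 1 * f k = f k * f 1; rw [← map_mul, ← map_mul, mul_comm])
  have c2 : ∀ k, MulOpposite.op (f' k) • i' = k • i' := fun k => Subtype.ext (by
    rw [hs']; change f' 1 * f' k = f' k * f' 1; rw [← map_mul, ← map_mul, mul_comm])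
  have d1 : ∀ x : auxIdeal f, MulOpposite.op (x : B) • i = x := fun x => Subtype.ext x.2
  have d2 : ∀ x : auxIdeal f', MulOpposite.op (x : B) • i' = x := fun x => Subtype.ext x.2
  refine ⟨e i, e.symm i', fun k => ?_, fun k => ?_, ?_, ?_, (e i).2, (e.symm i').2⟩
  · have := he2 (MulOpposite.op (f k)) i
    rw [c1, he1] at this
    exact (congrArg Subtype.val this).symm
  · have := hi2 (MulOpposite.op (f' k)) i'
    rw [c2, hi1] at this
    exact (congrArg Subtype.val this).symm
  · have := hi2 (MulOpposite.op (e i : B)) i'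
    rw [d2, AddEquiv.symm_apply_apply] at this
    exact (congrArg Subtype.val this).symm
  · have := he2 (MulOpposite.op (e.symm i' : B)) i
    rw [d1, AddEquiv.apply_symm_apply] at this
    exact (congrArg Subtype.val this).symm

theorem aux_free {F L M M' : Type*} [Field F] [CommRing L] [Nontrivial L] [Algebra F L]
    [FiniteDimensional F L] [AddCommGroup M] [AddCommGroup M'] [Module F M] [Module F M']
    [Module L M] [Module L M'] [IsScalarTower F L M] [IsScalarTower F L M']
    [FiniteDimensional F M] [FiniteDimensional F M'] [Module.Free L M] [Module.Free L M']
    (h : Module.finrank F M = Module.finrank F M') : 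
    ∃ ψ : M ≃ₗ[F] M', ∀ (x : L) b, ψ (x • b) = x • ψ b := by
  have : Module.Finite L M := Module.Finite.of_restrictScalars_finite F L M
  have : Module.Finite L M' := Module.Finite.of_restrictScalars_finite F L M'
  rw [← Module.finrank_mul_finrank F L M, ← Module.finrank_mul_finrank F L M'] at h
  let e := LinearEquiv.ofFinrankEq M M' (R := L)
    (Nat.eq_of_mul_eq_mul_left Module.finrank_pos h)
  exact ⟨e.restrictScalars F, fun x b => e.map_smul x b⟩

theorem aux_psi (F : Type u) [Field F] (B : Type u) [Ring B] [Algebra F B]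
    [FiniteDimensional F B]
    (L : Type u) [CommRing L] [Nontrivial L] [Algebra F L] [FiniteDimensional F L]
    (ι ι' : L →ₐ[F] B)
    (hfree : letI : Module L B := Module.compHom B ι.toRingHom; Module.Free L B)
    (hfree' : letI : Module L B := Module.compHom B ι'.toRingHom; Module.Free L B) :
    ∃ ψ : B ≃ₗ[F] B, ∀ x b, ψ (ι x * b) = ι' x * ψ b := by
  let m1 : Module L B := Module.compHom B ι.toRingHom
  let m2 : Module L B := Module.compHom B ι'.toRingHom
  have t1 : @IsScalarTower F L B _ m1.toSMul _ := by
    refine @IsScalarTower.mk F L B _ m1.toSMul _ fun c x b => ?_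
    change ι (c • x) * b = c • (ι x * b)
    rw [map_smul, smul_mul_assoc]
  have t2 : @IsScalarTower F L B _ m2.toSMul _ := by
    refine @IsScalarTower.mk F L B _ m2.toSMul _ fun c x b => ?_
    change ι' (c • x) * b = c • (ι' x * b)
    rw [map_smul, smul_mul_assoc]
  exact @aux_free F L B B _ _ _ _ _ _ _ _ _ m1 m2 t1 t2 _ _ hfree hfree' rfl

/-- The non-unital inclusion of a factor of `L` followed by `ι`. -/
noncomputable def auxFactor {F B L : Type*} [Field F] [Ring B] [Algebra F B] [CommRing L]
    [Algebra F L] [IsArtinianRing L] [IsReduced L] [DecidableEq (MaximalSpectrum L)]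
    (ι : L →ₐ[F] B) (m : MaximalSpectrum L) : (L ⧸ m.asIdeal) →ₙₐ[F] B where
  toFun k := ι ((IsArtinianRing.equivPi L).symm (Pi.single m k))
  map_zero' := by simp
  map_add' a b := by rw [Pi.single_add, map_add, map_add]
  map_mul' a b := by rw [Pi.single_mul, map_mul, map_mul]
  map_smul' c a := by
    rw [MonoidHom.id_apply, ← map_smul, Pi.single_smul]
    congr 1
    rw [AlgEquiv.symm_apply_eq, ← algebraMap_smul L c, ← algebraMap_smul L c, map_smul,
      AlgEquiv.apply_symm_apply]

theorem etale_embeddings_conjugate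
    (F : Type u) [Field F] (B : Type u) [Ring B] [Algebra F B]
    [FiniteDimensional F B] [Algebra.IsCentral F B] [IsSimpleRing B]
    (L : Type u) [CommRing L] [Algebra F L] [FiniteDimensional F L] [Algebra.Etale F L]
    (ι ι' : L →ₐ[F] B)
    (hinj : Function.Injective ι) (hinj' : Function.Injective ι')
    (hfree : letI : Module L B := Module.compHom B ι.toRingHom; Module.Free L B)
    (hfree' : letI : Module L B := Module.compHom B ι'.toRingHom; Module.Free L B) :
    ∃ u : Bˣ, ∀ x : L, ι' x = (u : B) * ι x * ((u⁻¹ : Bˣ) : B) := by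
  classical
  have : Nontrivial L := ι.toRingHom.domain_nontrivial
  have : IsReduced L := Algebra.FormallyUnramified.isReduced_of_field F L
  have : IsArtinianRing L := IsArtinianRing.of_finite F L
  have : Fintype (MaximalSpectrum L) := Fintype.ofFinite _
  obtain ⟨ψ, hψ⟩ := aux_psi F B L ι ι' hfree hfree'
  let E := IsArtinianRing.equivPi L
  let s : ∀ m : MaximalSpectrum L, L ⧸ m.asIdeal → L := fun m k => E.symm (Pi.single m k)
  have hf : ∀ (j : L →ₐ[F] B) m k, auxFactor j m k = j (s m k) := fun _ _ _ => rfl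
  have key : ∀ m : MaximalSpectrum L, ∃ u v : B, (∀ k, u * ι (s m k) = ι' (s m k) * u) ∧
      (∀ k, v * ι' (s m k) = ι (s m k) * v) ∧ v * u = ι (s m 1) ∧
      u * v = ι' (s m 1) ∧ ι' (s m 1) * u = u ∧ ι (s m 1) * v = v := by
    intro m
    let _ : Field (L ⧸ m.asIdeal) := Ideal.Quotient.field m.asIdeal
    refine aux_local (auxFactor ι m) (auxFactor ι' m) ?_
    have hmap : ((auxIdeal (auxFactor ι m)).restrictScalars F).map (ψ : B →ₗ[F] B)
        = (auxIdeal (auxFactor ι' m)).restrictScalars F := by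
      ext b
      rw [Submodule.mem_map_equiv]
      change auxFactor ι m 1 * _ = _ ↔ auxFactor ι' m 1 * _ = _
      rw [hf, hf, ← ψ.injective.eq_iff, hψ, ψ.apply_symm_apply]
    have := LinearEquiv.finrank_map_eq ψ ((auxIdeal (auxFactor ι m)).restrictScalars F)
    rw [hmap] at this
    exact this.symm
  choose u v hu hv hvu huv hu1 hv1 using key
  have hmul : ∀ m x, s m 1 * x = s m (Ideal.Quotient.mk _ x) := by
    intro m x
    apply E.injective
    simp only [s, map_mul, E.apply_symm_apply]
    ext n
    by_cases h : n = m
    · subst h; simp [E]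
    · simp [Pi.single_eq_of_ne h]
  have hsum : ∑ m, s m 1 = 1 := by
    apply E.injective
    simp only [s, map_sum, E.apply_symm_apply, map_one]
    exact Finset.univ_sum_single (1 : ∀ m : MaximalSpectrum L, L ⧸ m.asIdeal)
  have horth : ∀ m n, m ≠ n → s m 1 * s n 1 = 0 := by
    intro m n h
    apply E.injective
    simp only [s, map_mul, E.apply_symm_apply, map_zero]
    ext l
    by_cases h : l = m
    · subst h; simp [Pi.single_eq_of_ne ‹l ≠ n›]
    · simp [Pi.single_eq_of_ne h]
  have hux : ∀ m x, u m * ι x = ι' x * u m := by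
    intro m x
    rw [← hu1 m, ← hu m, mul_assoc, ← map_mul, hmul, hu, ← hmul, mul_comm, map_mul, mul_assoc, hu]
  have hvx : ∀ m x, v m * ι' x = ι x * v m := by
    intro m x
    rw [← hv1 m, ← hv m, mul_assoc, ← map_mul, hmul, hv, ← hmul, mul_comm, map_mul, mul_assoc, hv]
  have hvu0 : ∀ m n, m ≠ n → v m * u n = 0 := by
    intro m n h
    rw [← hu1 n, ← hv1 m, ← hv m, mul_assoc, ← mul_assoc (ι' _), ← map_mul, horth m n h]
    simp
  have huv0 : ∀ m n, m ≠ n → u m * v n = 0 := by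
    intro m n h
    rw [← hv1 n, ← hu1 m, ← hu m, mul_assoc, ← mul_assoc (ι _), ← map_mul, horth m n h]
    simp
  have e1 : (∑ m, u m) * (∑ m, v m) = 1 := by
    rw [Finset.sum_mul_sum, ← map_one ι', ← hsum, map_sum]
    refine Finset.sum_congr rfl fun m _ => ?_
    rw [Finset.sum_eq_single m (fun n _ hn => huv0 m n hn.symm) (by simp), huv]
  have e2 : (∑ m, v m) * (∑ m, u m) = 1 := by
    rw [Finset.sum_mul_sum, ← map_one ι, ← hsum, map_sum]
    refine Finset.sum_congr rfl fun m _ => ?_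
    rw [Finset.sum_eq_single m (fun n _ hn => hvu0 m n hn.symm) (by simp), hvu]
  refine ⟨⟨∑ m, u m, ∑ m, v m, e1, e2⟩, fun x => ?_⟩
  change ι' x = (∑ m, u m) * ι x * (∑ m, v m)
  have : (∑ m, u m) * ι x = ι' x * ∑ m, u m := by
    rw [Finset.sum_mul, Finset.mul_sum]
    exact Finset.sum_congr rfl fun m _ => hux m x
  rw [this, mul_assoc, e1, mul_one]
end

section
/- Assume K = K₃ + K₃·y for some element y ∈ K. Then Φ₁(y) − Φ₂(τ(y)) = Φ₂(y) − Φ₁(τ(y)); moreover, for every x ∈ K: (Φ₁(y) − Φ₂(τ(y)))·Φ₂(x) = Φ₁(x)·(Φ₁(y) − Φ₂(τ(y))); (Φ₁(y) − Φ₂(τ(y)))·Φ₁(x) = Φ₂(x)·(Φ₁(y) − Φ₂(τ(y))); (Φ₁(y) − Φ₂(y))·Φ₂(x) = Φ₁(τ(x))·(Φ₁(y) − Φ₂(y)); and (Φ₁(y) − Φ₂(y))·Φ₁(x) = Φ₂(τ(x))·(Φ₁(y) − Φ₂(y)). -/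
theorem aux_three {C : Type*} [Ring C] (p q p' q' : C) (hT : p + p' = q + q')
    (hN : p * p' = q * q') (h1 : p' * p = p * p') (h2 : q' * q = q * q') :
    (p - q') * q = p * (p - q') ∧ (p - q') * p = q * (p - q') ∧
    (p - q) * q = p' * (p - q) ∧ (p - q) * p = q' * (p - q) := by
  obtain rfl : q' = p + p' - q := by rw [hT]; abel
  simp only [mul_add, add_mul, mul_sub, sub_mul] at *
  refine ⟨?_, ?_, ?_, ?_⟩
  · rw [hN] at *
    rw [h2]; abel
  · rw [h1, hN]; abel
  · rw [h1, hN, ← h2]; abel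
  · rw [h1, hN, ← h2]; abel

/-- Intertwining relations.  `K` is a commutative `F`-algebra with an involution
`τ`, `K₃` is the fixed subalgebra, `C` is an `F`-algebra, and `Φ₁, Φ₂ : K → C`
are `F`-algebra homomorphisms agreeing on `K₃` and mapping `K₃` into the center
of `C`.  If `y` generates `K` over `K₃` (i.e. `K = K₃ + K₃·y`), then
`Φ₁(y) − Φ₂(τ y) = Φ₂(y) − Φ₁(τ y)`, and the displayed intertwining identities
hold for all `x ∈ K`. -/
theorem intertwining_relations
    (F : Type*) [Field F] (K : Type*) [CommRing K] [Algebra F K]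
    (τ : K ≃ₐ[F] K) (hτ : ∀ x : K, τ (τ x) = x)
    (C : Type*) [Ring C] [Algebra F C]
    (Φ₁ Φ₂ : K →ₐ[F] C)
    (hres : ∀ x : K, τ x = x → Φ₁ x = Φ₂ x)
    (hcen : ∀ x : K, τ x = x → ∀ c : C, Φ₁ x * c = c * Φ₁ x)
    (y : K) (hy : ∀ k : K, ∃ a b : K, τ a = a ∧ τ b = b ∧ k = a + b * y) :
    Φ₁ y - Φ₂ (τ y) = Φ₂ y - Φ₁ (τ y) ∧
    ∀ x : K,
      (Φ₁ y - Φ₂ (τ y)) * Φ₂ x = Φ₁ x * (Φ₁ y - Φ₂ (τ y)) ∧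
      (Φ₁ y - Φ₂ (τ y)) * Φ₁ x = Φ₂ x * (Φ₁ y - Φ₂ (τ y)) ∧
      (Φ₁ y - Φ₂ y) * Φ₂ x = Φ₁ (τ x) * (Φ₁ y - Φ₂ y) ∧
      (Φ₁ y - Φ₂ y) * Φ₁ x = Φ₂ (τ x) * (Φ₁ y - Φ₂ y) := by
  have hT : Φ₁ y + Φ₁ (τ y) = Φ₂ y + Φ₂ (τ y) := by
    have := hres (y + τ y) (by rw [map_add, hτ, add_comm])
    simpa only [map_add] using this
  have hN : Φ₁ y * Φ₁ (τ y) = Φ₂ y * Φ₂ (τ y) := by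
    have := hres (y * τ y) (by rw [map_mul, hτ, mul_comm])
    simpa only [map_mul] using this
  have h1 : Φ₁ (τ y) * Φ₁ y = Φ₁ y * Φ₁ (τ y) := by
    rw [← map_mul, ← map_mul, mul_comm]
  have h2 : Φ₂ (τ y) * Φ₂ y = Φ₂ y * Φ₂ (τ y) := by
    rw [← map_mul, ← map_mul, mul_comm]
  have key : ∀ (g h : K →ₐ[F] C) (z : C), (∀ a, τ a = a → g a = Φ₁ a) →
      (∀ a, τ a = a → h a = Φ₁ a) → z * g y = h y * z → ∀ x, z * g x = h x * z := by
    intro g h z hg hh hz x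
    obtain ⟨a, b, ha, hb, rfl⟩ := hy x
    rw [map_add, map_add, map_mul, map_mul, hg a ha, hg b hb, hh a ha, hh b hb,
      mul_add, add_mul, hcen a ha z, ← mul_assoc, ← hcen b hb z, mul_assoc, hz, mul_assoc]
  have e1 : ∀ a, τ a = a → Φ₁ a = Φ₁ a := fun _ _ => rfl
  have e2 : ∀ a, τ a = a → Φ₂ a = Φ₁ a := fun a ha => (hres a ha).symm
  have e3 : ∀ a, τ a = a → (Φ₁.comp τ.toAlgHom) a = Φ₁ a := fun a ha => congrArg Φ₁ ha
  have e4 : ∀ a, τ a = a → (Φ₂.comp τ.toAlgHom) a = Φ₁ a :=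
    fun a ha => (congrArg Φ₂ ha).trans (e2 a ha)
  obtain ⟨a1, a2, a3, a4⟩ := aux_three _ _ _ _ hT hN h1 h2
  refine ⟨?_, fun x => ⟨key Φ₂ Φ₁ _ e2 e1 a1 x, key Φ₁ Φ₂ _ e1 e2 a2 x,
    key Φ₂ (Φ₁.comp τ.toAlgHom) _ e2 e3 a3 x, key Φ₁ (Φ₂.comp τ.toAlgHom) _ e1 e4 a4 x⟩⟩
  rw [sub_eq_sub_iff_add_eq_add, hT]
end

section
/- Call y ∈ K a K₃-generator if K = K₃ + K₃·y and y − τ(y) is a unit of K (then (y − τ(y))² is a unit of K₃ and its image in C is central and invertible). For a K₃-generator y define s(y) = Φ₁((y − τ(y))²)⁻¹·(Φ₁(y) − Φ₂(τ(y)))² and t(y) = Φ₁((y − τ(y))²)⁻¹·(Φ₁(y)·Φ₂(y) − Φ₂(y)·Φ₁(y)) in C. Then: (i) for any two K₃-generators y₁, y₂ one has s(y₁) = s(y₂) and t(y₁) = t(y₂); (ii) writing s = s(y) and t = t(y), one has s·Φᵢ(x) = Φᵢ(x)·s and t·Φᵢ(x) = Φᵢ(τ(x))·t for all x ∈ K and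 both i = 1, 2; (iii) s·t = t·s. -/
/-- `y` is a `K₃`-generator of `K`: `K = K₃ + K₃·y` and `y − τ(y)` is a unit. -/
def IsK3Generator {F : Type*} [Field F] {K : Type*} [CommRing K] [Algebra F K]
    (τ : K ≃ₐ[F] K) (y : K) : Prop :=
  (∀ k : K, ∃ a b : K, τ a = a ∧ τ b = b ∧ k = a + b * y) ∧ IsUnit (y - τ y)

lemma gen_inv {F : Type*} [Field F] {K : Type*} [CommRing K] [Algebra F K]
    (τ : K ≃ₐ[F] K) (hτ : ∀ x : K, τ (τ x) = x)
    {C : Type*} [Ring C] [Algebra F C] (Φ : K →ₐ[F] C) (y : K) (hy : IsUnit (y - τ y)) :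
    ∃ f : K, (y - τ y) * f = 1 ∧ τ (f ^ 2) = f ^ 2 ∧
      Ring.inverse (Φ ((y - τ y) ^ 2)) = Φ (f ^ 2) := by
  obtain ⟨f, hf⟩ := hy.exists_right_inv
  have h1 : τ ((y - τ y) * f) = 1 := by rw [hf, map_one]
  rw [map_mul, map_sub, hτ] at h1
  have h2 : τ f = - f := by linear_combination (-f) * h1 - (τ f) * hf
  refine ⟨f, hf, by rw [map_pow, h2]; ring, ?_⟩
  have hu : IsUnit (Φ ((y - τ y) ^ 2)) := (hy.pow 2).map Φ
  have h3 : Φ ((y - τ y) ^ 2) * Φ (f ^ 2) = 1 := by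
    rw [← map_mul, ← mul_pow, hf, one_pow, map_one]
  calc _ = Ring.inverse (Φ ((y - τ y) ^ 2)) * (Φ ((y - τ y) ^ 2) * Φ (f ^ 2)) := by
        rw [h3, mul_one]
    _ = _ := by rw [← mul_assoc, Ring.inverse_mul_cancel _ hu, one_mul]

/-- The relation `c Y = Y' c` for the commutator `c = YZ - ZY`. -/
lemma comm_rel {C : Type*} [Ring C] (Y Y' Z : C)
    (hT : (Y + Y') * Z = Z * (Y + Y')) (hN : (Y' * Y) * Z = Z * (Y' * Y)) :
    (Y * Z - Z * Y) * Y = Y' * (Y * Z - Z * Y) := by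
  have h : (Y * Z - Z * Y) * Y - Y' * (Y * Z - Z * Y) =
      ((Y + Y') * Z - Z * (Y + Y')) * Y - ((Y' * Y) * Z - Z * (Y' * Y)) := by noncomm_ring
  rw [hT, hN, sub_self, sub_self, zero_mul, sub_self] at h
  exact sub_eq_zero.mp h

lemma u_rel {C : Type*} [Ring C] (Y Y' Z Z' : C) (hT : Y + Y' = Z + Z')
    (hN : Y' * Y = Z * Z') : (Y - Z') * Y = Z * (Y - Z') := by
  have h : (Y - Z') * Y - Z * (Y - Z') =
      (Y + Y' - (Z + Z')) * Y - (Y' * Y - Z * Z') := by noncomm_ring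
  rw [hT, hN, sub_self, sub_self, zero_mul, sub_self] at h
  exact sub_eq_zero.mp h

/-- Independence of the elements `s` and `t` of the choice of `K₃`-generator,
together with the commutation relations `s·Φᵢ(x) = Φᵢ(x)·s`,
`t·Φᵢ(x) = Φᵢ(τ x)·t`, and `s·t = t·s`. -/
theorem s_t_welldefined_and_commutation
    (F : Type*) [Field F] (K : Type*) [CommRing K] [Algebra F K]
    (τ : K ≃ₐ[F] K) (hτ : ∀ x : K, τ (τ x) = x)
    (C : Type*) [Ring C] [Algebra F C]
    (Φ₁ Φ₂ : K →ₐ[F] C)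
    (hres : ∀ x : K, τ x = x → Φ₁ x = Φ₂ x)
    (hcen : ∀ x : K, τ x = x → ∀ c : C, Φ₁ x * c = c * Φ₁ x) :
    let s : K → C := fun y => Ring.inverse (Φ₁ ((y - τ y) ^ 2)) * (Φ₁ y - Φ₂ (τ y)) ^ 2
    let t : K → C := fun y => Ring.inverse (Φ₁ ((y - τ y) ^ 2)) * (Φ₁ y * Φ₂ y - Φ₂ y * Φ₁ y)
    (∀ y₁ y₂ : K, IsK3Generator τ y₁ → IsK3Generator τ y₂ → s y₁ = s y₂ ∧ t y₁ = t y₂) ∧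
    (∀ y : K, IsK3Generator τ y → ∀ x : K,
      (s y * Φ₁ x = Φ₁ x * s y ∧ s y * Φ₂ x = Φ₂ x * s y) ∧
      (t y * Φ₁ x = Φ₁ (τ x) * t y ∧ t y * Φ₂ x = Φ₂ (τ x) * t y)) ∧
    (∀ y : K, IsK3Generator τ y → s y * t y = t y * s y) := by
  intro s t
  -- the commutation relations for the generator itself, without the central factor
  have key : ∀ y : K,
      ((Φ₁ y - Φ₂ (τ y)) ^ 2 * Φ₁ y = Φ₁ y * (Φ₁ y - Φ₂ (τ y)) ^ 2 ∧
       (Φ₁ y - Φ₂ (τ y)) ^ 2 * Φ₂ y = Φ₂ y * (Φ₁ y - Φ₂ (τ y)) ^ 2) ∧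
      ((Φ₁ y * Φ₂ y - Φ₂ y * Φ₁ y) * Φ₁ y = Φ₁ (τ y) * (Φ₁ y * Φ₂ y - Φ₂ y * Φ₁ y) ∧
       (Φ₁ y * Φ₂ y - Φ₂ y * Φ₁ y) * Φ₂ y = Φ₂ (τ y) * (Φ₁ y * Φ₂ y - Φ₂ y * Φ₁ y)) := by
    intro y
    have fT : τ (y + τ y) = y + τ y := by rw [map_add, hτ, add_comm]
    have fN : τ (τ y * y) = τ y * y := by rw [map_mul, hτ, mul_comm]
    have eT : Φ₁ y + Φ₁ (τ y) = Φ₂ y + Φ₂ (τ y) := by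
      rw [← map_add, ← map_add]; exact hres _ fT
    have eN : Φ₁ (τ y) * Φ₁ y = Φ₂ (τ y) * Φ₂ y := by
      rw [← map_mul, ← map_mul]; exact hres _ fN
    have eN2 : Φ₂ (τ y) * Φ₂ y = Φ₂ y * Φ₂ (τ y) := by
      rw [← map_mul, ← map_mul, mul_comm]
    have cT : ∀ c, (Φ₁ y + Φ₁ (τ y)) * c = c * (Φ₁ y + Φ₁ (τ y)) := by
      intro c; rw [← map_add]; exact hcen _ fT c
    have cN : ∀ c, (Φ₁ (τ y) * Φ₁ y) * c = c * (Φ₁ (τ y) * Φ₁ y) := by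
      intro c; rw [← map_mul]; exact hcen _ fN c
    have u1 := u_rel (Φ₁ y) (Φ₁ (τ y)) (Φ₂ y) (Φ₂ (τ y)) eT (eN.trans eN2)
    have u2 : (Φ₁ y - Φ₂ (τ y)) * Φ₂ y = Φ₁ y * (Φ₁ y - Φ₂ (τ y)) := by
      have h := u_rel (Φ₂ y) (Φ₂ (τ y)) (Φ₁ y) (Φ₁ (τ y)) eT.symm
        (by rw [← eN, ← map_mul, ← map_mul, mul_comm])
      have h' : Φ₂ y - Φ₁ (τ y) = Φ₁ y - Φ₂ (τ y) := by
        rw [sub_eq_sub_iff_add_eq_add]; exact eT.symm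
      rwa [h'] at h
    refine ⟨⟨?_, ?_⟩, comm_rel _ _ _ (cT _) (cN _), ?_⟩
    · rw [pow_two, mul_assoc, u1, ← mul_assoc, u2, mul_assoc]
    · rw [pow_two, mul_assoc, u2, ← mul_assoc, u1, mul_assoc]
    · have h := comm_rel (Φ₂ y) (Φ₂ (τ y)) (Φ₁ y) (by rw [← eT]; exact cT _)
        (by rw [← eN]; exact cN _)
      rw [← neg_sub (Φ₂ y * Φ₁ y), neg_mul, mul_neg, h]
  have part2 : ∀ y : K, IsK3Generator τ y → ∀ x : K,
      (s y * Φ₁ x = Φ₁ x * s y ∧ s y * Φ₂ x = Φ₂ x * s y) ∧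
      (t y * Φ₁ x = Φ₁ (τ x) * t y ∧ t y * Φ₂ x = Φ₂ (τ x) * t y) := by
    intro y hy x
    obtain ⟨f, -, hf, hinv⟩ := gen_inv τ hτ Φ₁ y hy.2
    obtain ⟨a, b, ha, hb, rfl⟩ := hy.1 x
    obtain ⟨⟨k1, k2⟩, k3, k4⟩ := key y
    simp only [s, t, hinv]
    have cf := hcen _ hf
    have ca := hcen _ ha
    have cb := hcen _ hb
    -- any relation `w P = P' w` extends to `x = a + b y` and to central multiples of `w`
    have ext : ∀ w P P' : C, w * P = P' * w →
        Φ₁ (f ^ 2) * w * (Φ₁ a + Φ₁ b * P) = (Φ₁ a + Φ₁ b * P') * (Φ₁ (f ^ 2) * w) := by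
      intro w P P' h
      rw [mul_add, add_mul, ca]
      congr 1
      rw [← mul_assoc, ← cb, mul_assoc, mul_assoc, mul_assoc, h, ← mul_assoc (Φ₁ (f ^ 2)), cf,
        mul_assoc]
    simp only [map_add, map_mul, ha, hb, ← hres a ha, ← hres b hb]
    exact ⟨⟨ext _ _ _ k1, ext _ _ _ k2⟩, ext _ _ _ k3, ext _ _ _ k4⟩
  refine ⟨?_, part2, ?_⟩
  · intro y z hy hz
    obtain ⟨f, hf1, hf, hfi⟩ := gen_inv τ hτ Φ₁ y hy.2
    obtain ⟨g, hg1, hg, hgi⟩ := gen_inv τ hτ Φ₁ z hz.2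
    obtain ⟨a, b, ha, hb, hz'⟩ := hy.1 z
    have hτz : τ z = a + b * τ y := by rw [hz', map_add, map_mul, ha, hb]
    have hfg : f = b * g := by
      rw [hτz, hz'] at hg1
      linear_combination (-f) * hg1 + b * g * hf1
    have cb := hcen _ hb
    have ca := hcen _ ha
    have hF : Φ₁ (f ^ 2) = Φ₁ (g ^ 2) * (Φ₁ b * Φ₁ b) := by
      rw [← map_mul, ← map_mul, hfg]; congr 1; ring
    have e1 : Φ₁ z = Φ₁ a + Φ₁ b * Φ₁ y := by rw [hz', map_add, map_mul]
    have e2 : Φ₂ z = Φ₁ a + Φ₁ b * Φ₂ y := by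
      rw [hz', map_add, map_mul, hres a ha, hres b hb]
    have e3 : Φ₂ (τ z) = Φ₁ a + Φ₁ b * Φ₂ (τ y) := by
      rw [hτz, map_add, map_mul, hres a ha, hres b hb]
    have mm : ∀ P Q : C, Φ₁ b * P * (Φ₁ b * Q) = Φ₁ b * Φ₁ b * (P * Q) := by
      intro P Q
      rw [mul_assoc, ← mul_assoc P, ← cb P]; simp only [mul_assoc]
    constructor
    · simp only [s, hfi, hgi, hF]
      rw [e1, e3, add_sub_add_left_eq_sub, ← mul_sub, pow_two (Φ₁ b * _), mm, pow_two (Φ₁ y - _)]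
      simp only [mul_assoc]
    · simp only [t, hfi, hgi, hF]
      have : Φ₁ z * Φ₂ z - Φ₂ z * Φ₁ z = Φ₁ b * Φ₁ b * (Φ₁ y * Φ₂ y - Φ₂ y * Φ₁ y) := by
        rw [e1, e2, add_mul, mul_add, mul_add, add_mul, mul_add, mul_add, mm, mm,
          ca (Φ₁ b * Φ₂ y), ca (Φ₁ b * Φ₁ y), mul_sub]
        abel
      rw [this, mul_assoc]
  · intro y hy
    obtain ⟨f, -, hf, hinv⟩ := gen_inv τ hτ Φ₁ y hy.2
    have h1 : Commute (s y) (Φ₁ y) := (part2 y hy y).1.1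
    have h2 : Commute (s y) (Φ₂ y) := (part2 y hy y).1.2
    have h3 : Commute (s y) (Φ₁ (f ^ 2)) := (part2 y hy (f ^ 2)).1.1
    have h4 : t y = Φ₁ (f ^ 2) * (Φ₁ y * Φ₂ y - Φ₂ y * Φ₁ y) := by simp only [t, hinv]
    rw [h4]
    exact h3.mul_right ((h1.mul_right h2).sub_right (h2.mul_right h1))
end

section
/- Let σ₃^C denote the F-algebra automorphism id_B ⊗ σ₃ of C = B ⊗_F K₃. Fix a K₃-generator y ∈ K (K = K₃ + K₃·y and y − τ₃(y) a unit of K) and let s = ((y − τ₃(y))²)⁻¹ · (Φ̃₁(y) − Φ̃₂(τ₃(y)))² ∈ C. Then σ₃^C(s) = ((y − τ₃(y))²)⁻¹ · (Φ̃₁(y) − Φ̃₂(y))². -/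
open TensorProduct

set_option synthInstance.maxHeartbeats 1000000
set_option maxHeartbeats 2000000

universe u

/-- `τ₃ = σ₁ ⊗ σ₂` on `K = K₁ ⊗[F] K₂`. -/
noncomputable def tau3 {F : Type u} [Field F] {K₁ K₂ : Type u}
    [CommRing K₁] [CommRing K₂] [Algebra F K₁] [Algebra F K₂]
    (σ₁ : K₁ ≃ₐ[F] K₁) (σ₂ : K₂ ≃ₐ[F] K₂) :
    (K₁ ⊗[F] K₂) ≃ₐ[F] (K₁ ⊗[F] K₂) :=
  Algebra.TensorProduct.congr σ₁ σ₂

/-- `τ₁ = id ⊗ σ₂` on `K = K₁ ⊗[F] K₂`. -/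
noncomputable def tau1 {F : Type u} [Field F] {K₁ K₂ : Type u}
    [CommRing K₁] [CommRing K₂] [Algebra F K₁] [Algebra F K₂]
    (σ₂ : K₂ ≃ₐ[F] K₂) :
    (K₁ ⊗[F] K₂) ≃ₐ[F] (K₁ ⊗[F] K₂) :=
  Algebra.TensorProduct.congr AlgEquiv.refl σ₂

/-- `K₃ ⊆ K₁ ⊗[F] K₂`, the subalgebra of `τ₃`-fixed elements. -/
noncomputable def K3 {F : Type u} [Field F] {K₁ K₂ : Type u}
    [CommRing K₁] [CommRing K₂] [Algebra F K₁] [Algebra F K₂]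
    (σ₁ : K₁ ≃ₐ[F] K₁) (σ₂ : K₂ ≃ₐ[F] K₂) : Subalgebra F (K₁ ⊗[F] K₂) :=
  AlgHom.equalizer (tau3 σ₁ σ₂).toAlgHom (AlgHom.id F _)

theorem aux_unit {F : Type u} [Field F] {K : Type u} [CommRing K] [Algebra F K]
    [Algebra.Etale F K] (hdim : Module.finrank F K = 2) (σ : K ≃ₐ[F] K)
    (hσ : ∀ x : K, σ (σ x) = x)
    (hfix : ∀ x : K, σ x = x ↔ ∃ a : F, algebraMap F K a = x) :
    ∃ x : K, IsUnit (x - σ x) := by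
  have hred : IsReduced K := Algebra.FormallyUnramified.isReduced_of_field F K
  have hex : ∃ x : K, σ x ≠ x := by
    by_contra! hc
    have hb : Function.Surjective (Algebra.linearMap F K) := fun x => (hfix x).1 (hc x)
    have := LinearMap.finrank_le_finrank_of_surjective hb
    rw [hdim, Module.finrank_self] at this
    omega
  obtain ⟨x, hx⟩ := hex
  refine ⟨x, ?_⟩
  have hd : x - σ x ≠ 0 := fun h => hx (sub_eq_zero.1 h).symm
  obtain ⟨a, ha⟩ := (hfix ((x - σ x) ^ 2)).1 (by rw [map_pow, map_sub, hσ]; ring)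
  have ha0 : a ≠ 0 := by
    rintro rfl
    rw [map_zero] at ha
    exact hd (pow_eq_zero_iff (two_ne_zero) |>.1 ha.symm)
  have hu : IsUnit ((x - σ x) ^ 2) := ha ▸ (IsUnit.mk0 a ha0).map (algebraMap F K)
  exact (isUnit_pow_iff two_ne_zero).1 hu

theorem mem_K3' {F : Type u} [Field F] {K₁ K₂ : Type u}
    [CommRing K₁] [CommRing K₂] [Algebra F K₁] [Algebra F K₂]
    (σ₁ : K₁ ≃ₐ[F] K₁) (σ₂ : K₂ ≃ₐ[F] K₂) (k : K₁ ⊗[F] K₂) :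
    k ∈ K3 σ₁ σ₂ ↔ tau3 σ₁ σ₂ k = k := Iff.rfl

theorem tr_mem {F : Type u} [Field F] {K₁ K₂ : Type u}
    [CommRing K₁] [CommRing K₂] [Algebra F K₁] [Algebra F K₂]
    (σ₁ : K₁ ≃ₐ[F] K₁) (σ₂ : K₂ ≃ₐ[F] K₂)
    (hσ₁ : ∀ x : K₁, σ₁ (σ₁ x) = x) (hσ₂ : ∀ x : K₂, σ₂ (σ₂ x) = x) (x : K₁) (z : K₂) :
    x ⊗ₜ[F] z + σ₁ x ⊗ₜ[F] σ₂ z ∈ K3 σ₁ σ₂ := by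
  rw [mem_K3']
  simp [tau3, hσ₁, hσ₂, add_comm]

theorem ext_left {F : Type u} [Field F] {K₁ K₂ : Type u}
    [CommRing K₁] [CommRing K₂] [Algebra F K₁] [Algebra F K₂]
    (σ₁ : K₁ ≃ₐ[F] K₁) (σ₂ : K₂ ≃ₐ[F] K₂)
    (hσ₁ : ∀ x : K₁, σ₁ (σ₁ x) = x) (hσ₂ : ∀ x : K₂, σ₂ (σ₂ x) = x)
    (hu : ∃ x : K₁, IsUnit (x - σ₁ x)) {C : Type u} [Ring C] [Algebra F C]
    (f g : (K₁ ⊗[F] K₂) →ₐ[F] C) (h1 : ∀ x : K₁, f (x ⊗ₜ[F] 1) = g (x ⊗ₜ[F] 1))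
    (h3 : ∀ c ∈ K3 σ₁ σ₂, f c = g c) (k : K₁ ⊗[F] K₂) : f k = g k := by
  obtain ⟨x, hx⟩ := hu
  have h2 : ∀ z : K₂, f (1 ⊗ₜ[F] z) = g (1 ⊗ₜ[F] z) := by
    intro z
    have hU : IsUnit (f ((x - σ₁ x) ⊗ₜ[F] 1)) :=
      (hx.map (Algebra.TensorProduct.includeLeft : K₁ →ₐ[F] K₁ ⊗[F] K₂)).map f
    have key : ((x - σ₁ x) ⊗ₜ[F] (1 : K₂)) * (1 ⊗ₜ[F] z)
        = (x ⊗ₜ[F] z + σ₁ x ⊗ₜ[F] σ₂ z)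
          - (σ₁ x ⊗ₜ[F] 1) * ((1 : K₁) ⊗ₜ[F] z + σ₁ 1 ⊗ₜ[F] σ₂ z) := by
      simp [mul_add, sub_mul, TensorProduct.sub_tmul]
    apply hU.mul_left_cancel
    conv_rhs => rw [h1]
    rw [← map_mul, ← map_mul, key, map_sub, map_sub, map_mul, map_mul, h1,
      h3 _ (tr_mem σ₁ σ₂ hσ₁ hσ₂ x z), h3 _ (tr_mem σ₁ σ₂ hσ₁ hσ₂ 1 z)]
  induction k using TensorProduct.induction_on with
  | zero => simp
  | add a b ha hb => rw [map_add, map_add, ha, hb]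
  | tmul a b =>
    have : a ⊗ₜ[F] b = (a ⊗ₜ[F] (1 : K₂)) * ((1 : K₁) ⊗ₜ[F] b) := by simp
    rw [this, map_mul, map_mul, h1, h2]

theorem ext_right {F : Type u} [Field F] {K₁ K₂ : Type u}
    [CommRing K₁] [CommRing K₂] [Algebra F K₁] [Algebra F K₂]
    (σ₁ : K₁ ≃ₐ[F] K₁) (σ₂ : K₂ ≃ₐ[F] K₂)
    (hσ₁ : ∀ x : K₁, σ₁ (σ₁ x) = x) (hσ₂ : ∀ x : K₂, σ₂ (σ₂ x) = x)
    (hu : ∃ x : K₂, IsUnit (x - σ₂ x)) {C : Type u} [Ring C] [Algebra F C]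
    (f g : (K₁ ⊗[F] K₂) →ₐ[F] C) (h2 : ∀ x : K₂, f (1 ⊗ₜ[F] x) = g (1 ⊗ₜ[F] x))
    (h3 : ∀ c ∈ K3 σ₁ σ₂, f c = g c) (k : K₁ ⊗[F] K₂) : f k = g k := by
  obtain ⟨x, hx⟩ := hu
  have h1 : ∀ z : K₁, f (z ⊗ₜ[F] 1) = g (z ⊗ₜ[F] 1) := by
    intro z
    have hU : IsUnit (f (1 ⊗ₜ[F] (x - σ₂ x))) :=
      (hx.map (Algebra.TensorProduct.includeRight : K₂ →ₐ[F] K₁ ⊗[F] K₂)).map f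
    have key : ((1 : K₁) ⊗ₜ[F] (x - σ₂ x)) * (z ⊗ₜ[F] 1)
        = (z ⊗ₜ[F] x + σ₁ z ⊗ₜ[F] σ₂ x)
          - (1 ⊗ₜ[F] σ₂ x) * (z ⊗ₜ[F] (1 : K₂) + σ₁ z ⊗ₜ[F] σ₂ 1) := by
      simp [mul_add, sub_mul, TensorProduct.tmul_sub]
    apply hU.mul_left_cancel
    conv_rhs => rw [h2]
    rw [← map_mul, ← map_mul, key, map_sub, map_sub, map_mul, map_mul, h2,
      h3 _ (tr_mem σ₁ σ₂ hσ₁ hσ₂ z x), h3 _ (tr_mem σ₁ σ₂ hσ₁ hσ₂ z 1)]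
  induction k using TensorProduct.induction_on with
  | zero => simp
  | add a b ha hb => rw [map_add, map_add, ha, hb]
  | tmul a b =>
    have : a ⊗ₜ[F] b = (a ⊗ₜ[F] (1 : K₂)) * ((1 : K₁) ⊗ₜ[F] b) := by simp
    rw [this, map_mul, map_mul, h1, h2]

theorem tau1_tau3 {F : Type u} [Field F] {K₁ K₂ : Type u}
    [CommRing K₁] [CommRing K₂] [Algebra F K₁] [Algebra F K₂]
    (σ₁ : K₁ ≃ₐ[F] K₁) (σ₂ : K₂ ≃ₐ[F] K₂) (k : K₁ ⊗[F] K₂) :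
    tau1 σ₂ (tau3 σ₁ σ₂ k) = tau3 σ₁ σ₂ (tau1 σ₂ k) := by
  induction k using TensorProduct.induction_on with
  | zero => simp
  | add a b ha hb => simp only [map_add, ha, hb]
  | tmul a b => simp [tau1, tau3]

theorem tau3_tau3 {F : Type u} [Field F] {K₁ K₂ : Type u}
    [CommRing K₁] [CommRing K₂] [Algebra F K₁] [Algebra F K₂]
    (σ₁ : K₁ ≃ₐ[F] K₁) (σ₂ : K₂ ≃ₐ[F] K₂)
    (hσ₁ : ∀ x : K₁, σ₁ (σ₁ x) = x) (hσ₂ : ∀ x : K₂, σ₂ (σ₂ x) = x) (k : K₁ ⊗[F] K₂) :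
    tau3 σ₁ σ₂ (tau3 σ₁ σ₂ k) = k := by
  induction k using TensorProduct.induction_on with
  | zero => simp
  | add a b ha hb => simp only [map_add, ha, hb]
  | tmul a b => simp [tau3, hσ₁, hσ₂]

theorem final_alg {C : Type u} [Ring C] (u β D : C) (hu : IsUnit u) (hb : IsUnit β)
    (hc : ∀ z, β * z = z * β) :
    Ring.inverse (β ^ 2 * u) * (β * D) ^ 2 = Ring.inverse u * D ^ 2 := by
  have h1 : IsUnit (β ^ 2 * u) := (hb.pow 2).mul hu
  apply h1.mul_left_cancel
  rw [← mul_assoc, Ring.mul_inverse_cancel _ h1, one_mul, mul_assoc, ← mul_assoc u,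
    Ring.mul_inverse_cancel _ hu, one_mul]
  exact (show Commute β D from hc D).mul_pow 2

/-- Lemma on the conjugate of `s`:  `σ₃^C(s) = ((y − τ₃ y)²)⁻¹·(Φ̃₁(y) − Φ̃₂(y))²`,
where `σ₃^C = id_B ⊗ σ₃` on `C = B ⊗[F] K₃`. -/
theorem s_conj_formula
    (F : Type u) [Field F] (K₁ K₂ : Type u)
    [CommRing K₁] [CommRing K₂] [Algebra F K₁] [Algebra F K₂]
    [Algebra.Etale F K₁] [Algebra.Etale F K₂]
    (hdim₁ : Module.finrank F K₁ = 2) (hdim₂ : Module.finrank F K₂ = 2)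
    (σ₁ : K₁ ≃ₐ[F] K₁) (σ₂ : K₂ ≃ₐ[F] K₂)
    (hσ₁ : ∀ x : K₁, σ₁ (σ₁ x) = x) (hσ₂ : ∀ x : K₂, σ₂ (σ₂ x) = x)
    (hσ₁fix : ∀ x : K₁, σ₁ x = x ↔ ∃ a : F, algebraMap F K₁ a = x)
    (hσ₂fix : ∀ x : K₂, σ₂ x = x ↔ ∃ a : F, algebraMap F K₂ a = x)
    -- `σ₃`, the restriction of `τ₁ = id ⊗ σ₂` to `K₃`
    (σ₃ : K3 σ₁ σ₂ ≃ₐ[F] K3 σ₁ σ₂)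
    (hσ₃ : ∀ c : K3 σ₁ σ₂, ((σ₃ c : K3 σ₁ σ₂) : K₁ ⊗[F] K₂) = tau1 σ₂ (c : K₁ ⊗[F] K₂))
    -- the central simple algebra `B` of dimension `4h²`
    (h : ℕ) (hh : 0 < h)
    (B : Type u) [Ring B] [Algebra F B] [FiniteDimensional F B]
    [Algebra.IsCentral F B] [IsSimpleRing B]
    (hB : Module.finrank F B = 4 * h ^ 2)
    (Φ₁ : K₁ →ₐ[F] B) (Φ₂ : K₂ →ₐ[F] B)
    -- `Φ̃₁, Φ̃₂ : K → C = B ⊗[F] K₃`, the unique `K₃`-algebra extensions of `Φ₁, Φ₂`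
    (Φt₁ Φt₂ : (K₁ ⊗[F] K₂) →ₐ[F] B ⊗[F] (K3 σ₁ σ₂))
    (hΦt₁ : ∀ x : K₁, Φt₁ (x ⊗ₜ[F] (1 : K₂)) = Φ₁ x ⊗ₜ[F] (1 : K3 σ₁ σ₂))
    (hΦt₂ : ∀ x : K₂, Φt₂ ((1 : K₁) ⊗ₜ[F] x) = Φ₂ x ⊗ₜ[F] (1 : K3 σ₁ σ₂))
    (hΦt₁c : ∀ c : K3 σ₁ σ₂, Φt₁ (c : K₁ ⊗[F] K₂) = (1 : B) ⊗ₜ[F] c)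
    (hΦt₂c : ∀ c : K3 σ₁ σ₂, Φt₂ (c : K₁ ⊗[F] K₂) = (1 : B) ⊗ₜ[F] c)
    -- a `K₃`-generator `y` of `K`
    (y : K₁ ⊗[F] K₂)
    (hygen : ∀ k : K₁ ⊗[F] K₂, ∃ a b : K3 σ₁ σ₂, k = (a : K₁ ⊗[F] K₂) + (b : K₁ ⊗[F] K₂) * y)
    (hyunit : IsUnit (y - tau3 σ₁ σ₂ y)) :
    Algebra.TensorProduct.map (AlgHom.id F B) σ₃.toAlgHom
        (Ring.inverse (Φt₁ ((y - tau3 σ₁ σ₂ y) ^ 2)) * (Φt₁ y - Φt₂ (tau3 σ₁ σ₂ y)) ^ 2)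
      = Ring.inverse (Φt₁ ((y - tau3 σ₁ σ₂ y) ^ 2)) * (Φt₁ y - Φt₂ y) ^ 2 := by
  have hu₁ := aux_unit hdim₁ σ₁ hσ₁ hσ₁fix
  have hu₂ := aux_unit hdim₂ σ₂ hσ₂ hσ₂fix
  set S := Algebra.TensorProduct.map (AlgHom.id F B) σ₃.toAlgHom with hS
  have hSc : ∀ (b : B) (c : K3 σ₁ σ₂), S (b ⊗ₜ[F] c) = b ⊗ₜ[F] σ₃ c := fun b c => by simp [hS]
  have e1 : ∀ k, S (Φt₁ k) = Φt₁ (tau1 σ₂ k) := by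
    refine ext_left σ₁ σ₂ hσ₁ hσ₂ hu₁ (S.comp Φt₁) (Φt₁.comp (tau1 σ₂).toAlgHom) ?_ ?_
    · intro x
      change S (Φt₁ _) = Φt₁ (tau1 σ₂ _)
      rw [show tau1 σ₂ (x ⊗ₜ[F] (1 : K₂)) = x ⊗ₜ[F] 1 by simp [tau1], hΦt₁, hSc, map_one]
    · intro c hc
      change S (Φt₁ _) = Φt₁ (tau1 σ₂ _)
      have := hσ₃ ⟨c, hc⟩
      rw [hΦt₁c ⟨c, hc⟩, hSc, ← this, hΦt₁c]
  have e2 : ∀ k, S (Φt₂ k) = Φt₂ (tau1 σ₂ (tau3 σ₁ σ₂ k)) := by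
    refine ext_right σ₁ σ₂ hσ₁ hσ₂ hu₂ (S.comp Φt₂)
      (Φt₂.comp ((tau1 σ₂).toAlgHom.comp (tau3 σ₁ σ₂).toAlgHom)) ?_ ?_
    · intro x
      change S (Φt₂ _) = Φt₂ (tau1 σ₂ (tau3 σ₁ σ₂ _))
      rw [show tau1 σ₂ (tau3 σ₁ σ₂ ((1 : K₁) ⊗ₜ[F] x)) = 1 ⊗ₜ[F] x by
        simp [tau1, tau3, hσ₂], hΦt₂, hSc, map_one]
    · intro c hc
      change S (Φt₂ _) = Φt₂ (tau1 σ₂ (tau3 σ₁ σ₂ _))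
      have := hσ₃ ⟨c, hc⟩
      rw [(mem_K3' σ₁ σ₂ c).1 hc, hΦt₂c ⟨c, hc⟩, hSc, ← this, hΦt₂c]
  obtain ⟨a, b, hab⟩ := hygen (tau1 σ₂ y)
  have hb3 : tau3 σ₁ σ₂ (b : K₁ ⊗[F] K₂) = b := (mem_K3' σ₁ σ₂ _).1 b.2
  have ha3 : tau3 σ₁ σ₂ (a : K₁ ⊗[F] K₂) = a := (mem_K3' σ₁ σ₂ _).1 a.2
  have hd : tau1 σ₂ (y - tau3 σ₁ σ₂ y) = b * (y - tau3 σ₁ σ₂ y) := by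
    rw [map_sub, tau1_tau3, hab, map_add, map_mul, ha3, hb3]
    ring
  have hbu : IsUnit (b : K₁ ⊗[F] K₂) := by
    have := hyunit.map (tau1 (K₁ := K₁) σ₂)
    rw [hd] at this
    exact isUnit_of_mul_isUnit_left this
  have hU : IsUnit (Φt₁ ((y - tau3 σ₁ σ₂ y) ^ 2)) := (hyunit.pow 2).map Φt₁
  have hβ : IsUnit ((1 : B) ⊗ₜ[F] b) := by
    rw [← hΦt₁c]
    exact hbu.map Φt₁
  have hcen : ∀ z, ((1 : B) ⊗ₜ[F] b) * z = z * ((1 : B) ⊗ₜ[F] b) := by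
    intro z
    induction z using TensorProduct.induction_on with
    | zero => simp
    | add p q hp hq => rw [mul_add, add_mul, hp, hq]
    | tmul p q => simp [mul_comm]
  have hinv : S (Ring.inverse (Φt₁ ((y - tau3 σ₁ σ₂ y) ^ 2)))
      = Ring.inverse (S (Φt₁ ((y - tau3 σ₁ σ₂ y) ^ 2))) := by
    apply (hU.map S).mul_left_cancel
    rw [Ring.mul_inverse_cancel _ (hU.map S), ← map_mul, Ring.mul_inverse_cancel _ hU, map_one]
  have hSu : S (Φt₁ ((y - tau3 σ₁ σ₂ y) ^ 2))
      = ((1 : B) ⊗ₜ[F] b) ^ 2 * Φt₁ ((y - tau3 σ₁ σ₂ y) ^ 2) := by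
    rw [e1, map_pow, hd, mul_pow, map_mul, map_pow Φt₁ (b : K₁ ⊗[F] K₂), hΦt₁c]
  have hSD : S (Φt₁ y - Φt₂ (tau3 σ₁ σ₂ y)) = ((1 : B) ⊗ₜ[F] b) * (Φt₁ y - Φt₂ y) := by
    rw [map_sub, e1, e2, tau3_tau3 σ₁ σ₂ hσ₁ hσ₂, hab, map_add, map_add, map_mul, map_mul,
      hΦt₁c, hΦt₂c, hΦt₁c, hΦt₂c, mul_sub]
    abel
  rw [map_mul, hinv, map_pow S, hSu, hSD]
  exact final_alg _ _ _ hU hβ hcen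
end

section
/- Fix a K₃-generator y ∈ K and let s = ((y − τ₃(y))²)⁻¹ · (Φ̃₁(y) − Φ̃₂(τ₃(y)))² ∈ M_{2h}(K₃). Then every monic polynomial Q ∈ K₃[T] of degree h satisfying Q² = charpoly(s) obeys the functional equation (−1)^h · Q(1 − T) = Q^{σ₃}(T), where Q^{σ₃} is the polynomial obtained from Q by applying σ₃ to each coefficient and Q(1 − T) denotes the composition of Q with the polynomial 1 − T. -/
open TensorProduct

set_option synthInstance.maxHeartbeats 1000000
set_option maxHeartbeats 2000000

universe u

lemma aux_gen {F : Type u} [Field F] {K : Type u} [CommRing K] [Algebra F K] [Algebra.Etale F K]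
    (hdim : Module.finrank F K = 2) (σ : K ≃ₐ[F] K) (hσ : ∀ x, σ (σ x) = x)
    (hfix : ∀ x : K, σ x = x ↔ ∃ a : F, algebraMap F K a = x) :
    ∃ (x : K) (t n : F), σ x = algebraMap F K t - x ∧ x * σ x = algebraMap F K n ∧
      t ^ 2 - 4 * n ≠ 0 := by
  have hred : IsReduced K := Algebra.FormallyUnramified.isReduced_of_field F K
  obtain ⟨x, hx⟩ : ∃ x : K, ¬ ∃ a : F, algebraMap F K a = x := by
    by_contra hcon
    push Not at hcon
    have : Module.finrank F K ≤ 1 := by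
      refine finrank_le_one (1 : K) fun w => ?_
      obtain ⟨a, ha⟩ := hcon w
      exact ⟨a, by rw [← ha, Algebra.algebraMap_eq_smul_one]⟩
    omega
  obtain ⟨t, ht⟩ := (hfix (x + σ x)).1 (by rw [map_add, hσ, add_comm])
  obtain ⟨n, hn⟩ := (hfix (x * σ x)).1 (by rw [map_mul, hσ, mul_comm])
  refine ⟨x, t, n, by rw [ht]; ring, hn.symm, fun h0 => ?_⟩
  have h1 : (x - σ x) ^ 2 = 0 := by
    have := congrArg (algebraMap F K) h0
    simp only [map_sub, map_pow, map_mul, ht, hn, map_zero, map_ofNat] at this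
    linear_combination this
  have h2 := pow_eq_zero_iff (two_ne_zero) |>.1 h1
  exact hx ((hfix x).1 (sub_eq_zero.1 h2).symm)

lemma aux_sqrt {F : Type u} [Field F] {R : Type u} [CommRing R] [Algebra F R] [IsReduced R]
    (A B : Polynomial R) (hA : A.Monic) (hB : B.Monic) (hd : A.natDegree = B.natDegree)
    (hAB : A ^ 2 = B ^ 2) : A = B := by
  nontriviality R
  by_cases h2 : (2 : F) = 0
  · have h2' : (2 : Polynomial R) = 0 := by
      have := congrArg (algebraMap F (Polynomial R)) h2
      simpa only [map_ofNat, map_zero] using this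
    have : (A - B) ^ 2 = 0 := by
      linear_combination hAB + (B ^ 2 - A * B) * h2'
    have hnil : IsNilpotent (A - B) := ⟨2, this⟩
    refine sub_eq_zero.1 (Polynomial.ext fun i => ?_)
    exact (Polynomial.isNilpotent_iff.1 hnil i).eq_zero
  · have h3 : (algebraMap F (Polynomial R) 2⁻¹) * 2 = 1 := by
      have := congrArg (algebraMap F (Polynomial R)) (inv_mul_cancel₀ h2)
      simpa only [map_mul, map_ofNat, map_one] using this
    have h2n : Polynomial.C (algebraMap F R 2⁻¹) * 2 = 1 := h3
    have h4 : (Polynomial.C (algebraMap F R 2⁻¹) * (A + B)).Monic := by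
      have e : Polynomial.C (algebraMap F R 2⁻¹) * (A + B)
         = A + Polynomial.C (algebraMap F R 2⁻¹) * (B - A) := by
        linear_combination A * h2n
      rw [e]
      refine hA.add_of_left ?_
      have hlt : (B - A).degree < A.degree := by
        have hdd : B.degree = A.degree := by
          rw [Polynomial.degree_eq_natDegree hA.ne_zero, Polynomial.degree_eq_natDegree hB.ne_zero, hd]
        rw [← hdd]
        exact Polynomial.degree_sub_lt_left hdd hB.ne_zero (by rw [hA.leadingCoeff, hB.leadingCoeff])
      refine lt_of_le_of_lt ?_ hlt
      rw [← Polynomial.smul_eq_C_mul]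
      exact Polynomial.degree_smul_le _ _
    have h5 : (A - B) * (Polynomial.C (algebraMap F R 2⁻¹) * (A + B)) = 0 := by
      linear_combination (Polynomial.C (algebraMap F R 2⁻¹)) * hAB
    exact sub_eq_zero.1 (h4.mem_nonZeroDivisors.2 _ h5)

lemma aux_charpoly {R : Type u} [CommRing R] {h : ℕ} (s : Matrix (Fin (2*h)) (Fin (2*h)) R) :
    (1 - s).charpoly = s.charpoly.comp (1 - Polynomial.X) := by
  have : s.charpoly.comp (1 - Polynomial.X) =
      (Polynomial.compRingHom (1 - Polynomial.X)) s.charpoly := rfl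
  rw [this, Matrix.charpoly, Matrix.charpoly, RingHom.map_det]
  have e : (Matrix.charmatrix (1 - s)) =
      -((Polynomial.compRingHom (1 - Polynomial.X)).mapMatrix s.charmatrix) := by
    ext1 i j
    by_cases hij : i = j
    · subst hij
      simp
      ring
    · simp [hij]
  rw [e, Matrix.det_neg]
  simp

lemma aux_mat {R : Type u} [Ring R] (X W t n : R) (hX : X * X = t * X - n) (hW : W * W = t * W - n)
    (htX : X * t = t * X) (htW : W * t = t * W) :
    (X - (t - W)) ^ 2 + (X - W) ^ 2 = t ^ 2 - 4 * n := by
  have e : (X - (t - W)) ^ 2 + (X - W) ^ 2 = 2 * (X * X) + 2 * (W * W) + t ^ 2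
      - (X * t + t * X) - (W * t + t * W) := by noncomm_ring
  rw [e, hX, hW, htX, htW]
  noncomm_ring

lemma aux_core {F : Type u} [Field F] {K C : Type u} [CommRing K] [CommRing C] [Algebra F K]
    [Algebra F C] {m : ℕ} (ι : C →ₐ[F] K) (σ : C →ₐ[F] C)
    (Φ Ψ : K →ₐ[F] Matrix (Fin m) (Fin m) C)
    (hΦ : ∀ c, Φ (ι c) = algebraMap C _ c) (hΨ : ∀ c, Ψ (ι c) = algebraMap C _ c)
    (x x' z z' y y' : K) (t n t₂ n₂ : F)
    (hx : x' = algebraMap F K t - x) (hxn : x * x' = algebraMap F K n) (hδ : t ^ 2 - 4 * n ≠ 0)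
    (hz : z' = algebraMap F K t₂ - z) (hzn : z * z' = algebraMap F K n₂)
    (hδ₂ : t₂ ^ 2 - 4 * n₂ ≠ 0)
    (A B a b : C) (hA : ι A = (z * x' - z' * x) * (z - z')) (hB : ι B = (x - x') * (z - z'))
    (hA' : ι (σ A) = (z' * x' - z * x) * (z' - z)) (hB' : ι (σ B) = (x - x') * (z' - z))
    (hxy : x = ι a + ι b * y) (hxy' : x' = ι a + ι b * y')
    (hu : IsUnit (y - y'))
    (hfx : σ.mapMatrix (Φ x) = Φ x) (hfz : σ.mapMatrix (Ψ z) = Ψ z) :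
    σ.mapMatrix (Ring.inverse (Φ ((y - y') ^ 2)) * (Φ y - Ψ y') ^ 2) =
      1 - Ring.inverse (Φ ((y - y') ^ 2)) * (Φ y - Ψ y') ^ 2 := by
  set s := Ring.inverse (Φ ((y - y') ^ 2)) * (Φ y - Ψ y') ^ 2 with hs
  have hcomm : ∀ (c : C) (M : Matrix (Fin m) (Fin m) C),
      algebraMap C _ c * M = M * algebraMap C _ c := fun c M => Algebra.commutes c M
  -- scaling
  have hD : Φ x - Ψ x' = algebraMap C _ b * (Φ y - Ψ y') := by
    rw [hxy', hxy, map_add, map_add, map_mul, map_mul, hΦ, hΦ, hΨ, hΨ]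
    noncomm_ring
  have hdd : algebraMap F K (t ^ 2 - 4 * n) = (x - x') ^ 2 := by
    simp only [map_sub, map_pow, map_mul, map_ofNat, ← hxn]
    linear_combination (-algebraMap F K t - x - x') * hx
  have hdd₂ : algebraMap F K (t₂ ^ 2 - 4 * n₂) = (z - z') ^ 2 := by
    simp only [map_sub, map_pow, map_mul, map_ofNat, ← hzn]
    linear_combination (-algebraMap F K t₂ - z - z') * hz
  have hbs : (t ^ 2 - 4 * n) • s = (Φ x - Ψ x') ^ 2 := by
    have hun : IsUnit (Φ ((y - y') ^ 2)) := (hu.pow 2).map Φ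
    have e1 : algebraMap F (Matrix (Fin m) (Fin m) C) (t ^ 2 - 4 * n) =
        algebraMap C _ b * (algebraMap C _ b * Φ ((y - y') ^ 2)) := by
      rw [← hΦ, ← map_mul, ← map_mul, ← Φ.commutes, hdd, hxy, hxy']
      congr 1
      ring
    rw [Algebra.smul_def, e1, hs, hD, mul_assoc, mul_assoc, ← mul_assoc (Φ _) (Ring.inverse _),
      Ring.mul_inverse_cancel _ hun, one_mul, sq, sq]
    simp only [mul_assoc]
    rw [← mul_assoc (Φ y - Ψ y') (algebraMap C _ b), ← hcomm b]
    simp only [mul_assoc]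
  have hW : σ.mapMatrix (Ψ x') = Ψ x := by
    have h1 : (t₂ ^ 2 - 4 * n₂) • Ψ x = algebraMap C _ A + algebraMap C _ B * Ψ z := by
      rw [← hΨ, ← hΨ, ← map_mul, ← map_add, ← map_smul, Algebra.smul_def, hdd₂, hA, hB]
      congr 1; ring
    have h2 : (t₂ ^ 2 - 4 * n₂) • Ψ x' = algebraMap C _ (σ A) + algebraMap C _ (σ B) * Ψ z := by
      rw [← hΨ, ← hΨ, ← map_mul, ← map_add, ← map_smul, Algebra.smul_def, hdd₂, hA', hB']
      congr 1; ring
    have hal : ∀ c : C, σ.mapMatrix (algebraMap C (Matrix (Fin m) (Fin m) C) c)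
        = algebraMap C _ (σ c) := by
      intro c
      ext i j
      by_cases hij : i = j <;> simp [Matrix.algebraMap_matrix_apply, hij]
    have h3 : σ.mapMatrix (Ψ x) = Ψ x' := by
      have h4 := congrArg σ.mapMatrix h1
      rw [map_smul, map_add, map_mul, hal, hal, hfz, ← h2] at h4
      exact smul_right_injective _ hδ₂ h4
    have e : x' = algebraMap F K t - x := hx
    have e' : x = algebraMap F K t - x' := by rw [hx]; ring
    calc σ.mapMatrix (Ψ x') = σ.mapMatrix (algebraMap F _ t - Ψ x) := by
          rw [hx, map_sub Ψ, Ψ.commutes]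
      _ = algebraMap F _ t - Ψ x' := by rw [map_sub, AlgHom.commutes, h3]
      _ = Ψ x := by rw [← Ψ.commutes, ← map_sub, ← e']
  have hsum : (t ^ 2 - 4 * n) • (σ.mapMatrix s + s) = (t ^ 2 - 4 * n) • 1 := by
    rw [smul_add, ← map_smul, hbs, map_pow, map_sub, hfx, hW]
    have e' : x = algebraMap F K t - x' := by rw [hx]; ring
    have e2 : Ψ x = algebraMap F _ t - Ψ x' := by
      rw [← Ψ.commutes, ← map_sub, ← e']
    have := aux_mat (Φ x) (Ψ x') (algebraMap F _ t) (algebraMap F _ n)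
      (by rw [← Φ.commutes, ← Φ.commutes, ← map_mul, ← map_mul, ← map_sub]
          congr 1
          rw [← hxn, hx]; ring)
      (by rw [← Ψ.commutes, ← Ψ.commutes, ← map_mul, ← map_mul, ← map_sub]
          congr 1
          rw [← hxn, hx]; ring)
      (Algebra.commutes _ _).symm (Algebra.commutes _ _).symm
    rw [e2, this, Algebra.smul_def, mul_one]
    simp only [map_sub, map_pow, map_mul, map_ofNat]
  exact eq_sub_of_add_eq (smul_right_injective _ hδ hsum)

lemma aux_comp {R : Type u} [CommRing R] [Nontrivial R] {h : ℕ} (Q : Polynomial R) (hQ : Q.Monic)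
    (hd : Q.natDegree = h) :
    ((-1 : Polynomial R) ^ h * Q.comp (1 - Polynomial.X)).Monic ∧
      ((-1 : Polynomial R) ^ h * Q.comp (1 - Polynomial.X)).natDegree = h := by
  have e : (-1 : Polynomial R) ^ h * Q.comp (1 - Polynomial.X) =
      ((-1) ^ h * Q.comp (-Polynomial.X)).comp (Polynomial.X - Polynomial.C 1) := by
    rw [Polynomial.mul_comp, Polynomial.comp_assoc]
    simp [sub_eq_add_neg, add_comm]
  have hm : ((-1) ^ h * Q.comp (-Polynomial.X)).Monic := by
    have := hQ.neg_one_pow_natDegree_mul_comp_neg_X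
    rwa [hd] at this
  have hcd : (Q.comp (-Polynomial.X)).natDegree = h := by
    rw [Polynomial.natDegree_comp_eq_of_mul_ne_zero]
    · simp [hd]
    · rw [hQ.leadingCoeff, one_mul, Polynomial.leadingCoeff_neg, Polynomial.leadingCoeff_X]
      exact (isUnit_one.neg.pow _).ne_zero
  have hdeg : ((-1) ^ h * Q.comp (-Polynomial.X)).natDegree = h := by
    rcases neg_one_pow_eq_or (Polynomial R) h with h1 | h1 <;> rw [h1] <;> simp [hcd]
  rw [e]
  exact ⟨hm.comp_X_sub_C 1, by
    rw [Polynomial.natDegree_comp_eq_of_mul_ne_zero]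
    · rw [hdeg, Polynomial.natDegree_X_sub_C, mul_one]
    · rw [hm.leadingCoeff, Polynomial.leadingCoeff_X_sub_C, one_pow, mul_one]
      exact one_ne_zero⟩

/-- The functional equation `(−1)^h · Q(1 − T) = Q^{σ₃}(T)` for any monic square
root `Q` of the characteristic polynomial of
`s = ((y − τ₃ y)²)⁻¹ · (Φ̃₁(y) − Φ̃₂(τ₃ y))² ∈ M_{2h}(K₃)`. -/
theorem invariant_polynomial_functional_equation
    (F : Type u) [Field F] (K₁ K₂ : Type u)
    [CommRing K₁] [CommRing K₂] [Algebra F K₁] [Algebra F K₂]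
    [Algebra.Etale F K₁] [Algebra.Etale F K₂]
    (hdim₁ : Module.finrank F K₁ = 2) (hdim₂ : Module.finrank F K₂ = 2)
    (σ₁ : K₁ ≃ₐ[F] K₁) (σ₂ : K₂ ≃ₐ[F] K₂)
    (hσ₁ : ∀ x : K₁, σ₁ (σ₁ x) = x) (hσ₂ : ∀ x : K₂, σ₂ (σ₂ x) = x)
    (hσ₁fix : ∀ x : K₁, σ₁ x = x ↔ ∃ a : F, algebraMap F K₁ a = x)
    (hσ₂fix : ∀ x : K₂, σ₂ x = x ↔ ∃ a : F, algebraMap F K₂ a = x)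
    -- `σ₃`, the restriction of `τ₁ = id ⊗ σ₂` to `K₃`
    (σ₃ : K3 σ₁ σ₂ ≃ₐ[F] K3 σ₁ σ₂)
    (hσ₃ : ∀ c : K3 σ₁ σ₂, ((σ₃ c : K3 σ₁ σ₂) : K₁ ⊗[F] K₂) = tau1 σ₂ (c : K₁ ⊗[F] K₂))
    (h : ℕ) (hh : 0 < h)
    (Φ₁ : K₁ →ₐ[F] Matrix (Fin (2*h)) (Fin (2*h)) F)
    (Φ₂ : K₂ →ₐ[F] Matrix (Fin (2*h)) (Fin (2*h)) F)
    -- `Φ̃₁, Φ̃₂ : K → M_{2h}(K₃)`, the unique `K₃`-algebra extensions of `Φ₁, Φ₂`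
    (Φt₁ Φt₂ : (K₁ ⊗[F] K₂) →ₐ[F] Matrix (Fin (2*h)) (Fin (2*h)) (K3 σ₁ σ₂))
    (hΦt₁ : ∀ x : K₁, Φt₁ (x ⊗ₜ[F] (1 : K₂)) = (Φ₁ x).map (algebraMap F (K3 σ₁ σ₂)))
    (hΦt₂ : ∀ x : K₂, Φt₂ ((1 : K₁) ⊗ₜ[F] x) = (Φ₂ x).map (algebraMap F (K3 σ₁ σ₂)))
    (hΦt₁c : ∀ c : K3 σ₁ σ₂,
      Φt₁ (c : K₁ ⊗[F] K₂) = algebraMap (K3 σ₁ σ₂) (Matrix (Fin (2*h)) (Fin (2*h)) (K3 σ₁ σ₂)) c)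
    (hΦt₂c : ∀ c : K3 σ₁ σ₂,
      Φt₂ (c : K₁ ⊗[F] K₂) = algebraMap (K3 σ₁ σ₂) (Matrix (Fin (2*h)) (Fin (2*h)) (K3 σ₁ σ₂)) c)
    -- a `K₃`-generator `y` of `K`
    (y : K₁ ⊗[F] K₂)
    (hygen : ∀ k : K₁ ⊗[F] K₂, ∃ a b : K3 σ₁ σ₂, k = (a : K₁ ⊗[F] K₂) + (b : K₁ ⊗[F] K₂) * y)
    (hyunit : IsUnit (y - tau3 σ₁ σ₂ y))
    -- a monic square root `Q` of the characteristic polynomial of `s`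
    (Q : Polynomial (K3 σ₁ σ₂)) (hQmonic : Q.Monic) (hQdeg : Q.natDegree = h)
    (hQ : Q ^ 2 = Matrix.charpoly
      (Ring.inverse (Φt₁ ((y - tau3 σ₁ σ₂ y) ^ 2)) * (Φt₁ y - Φt₂ (tau3 σ₁ σ₂ y)) ^ 2)) :
    (-1 : Polynomial (K3 σ₁ σ₂)) ^ h * Q.comp (1 - Polynomial.X)
      = Q.map σ₃.toAlgHom.toRingHom := by
  nontriviality (K3 σ₁ σ₂)
  obtain ⟨x, t, n, hx, hxn, hδ⟩ := aux_gen hdim₁ σ₁ hσ₁ hσ₁fix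
  obtain ⟨z, t₂, n₂, hz, hzn, hδ₂⟩ := aux_gen hdim₂ σ₂ hσ₂ hσ₂fix
  have hmem : ∀ k, k ∈ K3 σ₁ σ₂ ↔ tau3 σ₁ σ₂ k = k := fun k => Iff.rfl
  have h3x : ∀ w : K₁, tau3 σ₁ σ₂ (w ⊗ₜ[F] (1 : K₂)) = σ₁ w ⊗ₜ[F] (1 : K₂) := by
    intro w; simp [tau3]
  have h3z : ∀ w : K₂, tau3 σ₁ σ₂ ((1 : K₁) ⊗ₜ[F] w) = (1 : K₁) ⊗ₜ[F] σ₂ w := by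
    intro w; simp [tau3]
  have h1x : ∀ w : K₁, tau1 (K₁ := K₁) σ₂ (w ⊗ₜ[F] (1 : K₂)) = w ⊗ₜ[F] (1 : K₂) := by
    intro w; simp [tau1]
  have h1z : ∀ w : K₂, tau1 (K₁ := K₁) σ₂ ((1 : K₁) ⊗ₜ[F] w) = (1 : K₁) ⊗ₜ[F] σ₂ w := by
    intro w; simp [tau1]
  set X : K₁ ⊗[F] K₂ := x ⊗ₜ[F] (1 : K₂) with hX
  set X' : K₁ ⊗[F] K₂ := σ₁ x ⊗ₜ[F] (1 : K₂) with hX'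
  set Z : K₁ ⊗[F] K₂ := (1 : K₁) ⊗ₜ[F] z with hZ
  set Z' : K₁ ⊗[F] K₂ := (1 : K₁) ⊗ₜ[F] σ₂ z with hZ'
  have t3X : tau3 σ₁ σ₂ X = X' := h3x x
  have t3X' : tau3 σ₁ σ₂ X' = X := by rw [hX', h3x, hσ₁]
  have t3Z : tau3 σ₁ σ₂ Z = Z' := h3z z
  have t3Z' : tau3 σ₁ σ₂ Z' = Z := by rw [hZ', h3z, hσ₂]
  have t1X : tau1 σ₂ X = X := h1x x
  have t1X' : tau1 σ₂ X' = X' := h1x _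
  have t1Z : tau1 σ₂ Z = Z' := h1z z
  have t1Z' : tau1 σ₂ Z' = Z := by rw [hZ', h1z, hσ₂]
  have hA : (Z * X' - Z' * X) * (Z - Z') ∈ K3 σ₁ σ₂ := by
    rw [hmem, map_mul, map_sub, map_sub, map_mul, map_mul, t3X, t3X', t3Z, t3Z']; ring
  have hB : (X - X') * (Z - Z') ∈ K3 σ₁ σ₂ := by
    rw [hmem, map_mul, map_sub, map_sub, t3X, t3X', t3Z, t3Z']; ring
  obtain ⟨a, b, hab⟩ := hygen X
  have hab' : X' = (a : K₁ ⊗[F] K₂) + b * tau3 σ₁ σ₂ y := by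
    rw [← t3X, hab, map_add, map_mul, (hmem _).1 a.2, (hmem _).1 b.2]
  have hfix : ∀ M : Matrix (Fin (2*h)) (Fin (2*h)) F,
      (σ₃ : K3 σ₁ σ₂ →ₐ[F] K3 σ₁ σ₂).mapMatrix (M.map (algebraMap F (K3 σ₁ σ₂)))
        = M.map (algebraMap F (K3 σ₁ σ₂)) := by
    intro M
    ext1 i j
    exact AlgEquiv.commutes σ₃ _
  have key := aux_core (K3 σ₁ σ₂).val (σ₃ : K3 σ₁ σ₂ →ₐ[F] K3 σ₁ σ₂) Φt₁ Φt₂ hΦt₁c hΦt₂c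
    X X' Z Z' y (tau3 σ₁ σ₂ y) t n t₂ n₂
    (by rw [hX', hx, TensorProduct.sub_tmul]; rfl)
    (by rw [hX, hX', Algebra.TensorProduct.tmul_mul_tmul, hxn, mul_one]; rfl) hδ
    (by rw [hZ', hz, TensorProduct.tmul_sub, Algebra.TensorProduct.algebraMap_apply'])
    (by rw [hZ, hZ', Algebra.TensorProduct.tmul_mul_tmul, hzn, mul_one,
          Algebra.TensorProduct.algebraMap_apply']) hδ₂
    ⟨_, hA⟩ ⟨_, hB⟩ a b rfl rfl
    (by refine (hσ₃ _).trans ?_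
        rw [map_mul, map_sub, map_sub, map_mul, map_mul, t1X, t1X', t1Z, t1Z'])
    (by refine (hσ₃ _).trans ?_
        rw [map_mul, map_sub, map_sub, t1X, t1X', t1Z, t1Z'])
    hab hab' hyunit
    (by rw [hX, hΦt₁, hfix]) (by rw [hZ, hΦt₂, hfix])
  set s := Ring.inverse (Φt₁ ((y - tau3 σ₁ σ₂ y) ^ 2)) * (Φt₁ y - Φt₂ (tau3 σ₁ σ₂ y)) ^ 2 with hs
  have hredK : IsReduced (K₁ ⊗[F] K₂) := by
    have : Algebra.Etale F (K₁ ⊗[F] K₂) := Algebra.Etale.comp F K₁ _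
    exact Algebra.FormallyUnramified.isReduced_of_field F _
  have hred : IsReduced (K3 σ₁ σ₂) :=
    isReduced_of_injective (K3 σ₁ σ₂).val Subtype.val_injective
  have hQσ : (Q.map σ₃.toAlgHom.toRingHom) ^ 2 = Q.comp (1 - Polynomial.X) ^ 2 := by
    rw [← Polynomial.map_pow, ← Polynomial.pow_comp, hQ, ← aux_charpoly, ← key]
    exact (Matrix.charpoly_map s _).symm
  have hcomp : ((-1 : Polynomial (K3 σ₁ σ₂)) ^ h * Q.comp (1 - Polynomial.X)).Monic ∧
      ((-1 : Polynomial (K3 σ₁ σ₂)) ^ h * Q.comp (1 - Polynomial.X)).natDegree = h :=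
    aux_comp Q hQmonic hQdeg
  refine aux_sqrt (F := F) _ _ hcomp.1 (hQmonic.map _) ?_ ?_
  · rw [hcomp.2, hQmonic.natDegree_map, hQdeg]
  · rw [hQσ, mul_pow, ← pow_mul, mul_comm h 2, pow_mul]; simp
end

section
/- Let x₁ ∈ K₁ and x₂ ∈ K₂ be F-algebra generators (K₁ = F + F·x₁ and K₂ = F + F·x₂), and set w = Φ₁(x₁)·Φ₂(x₂) + Φ₂(σ₂(x₂))·Φ₁(σ₁(x₁)) and z = Φ₁(x₁)·Φ₂(x₂) − Φ₂(x₂)·Φ₁(x₁) in B. Inside K, the elements u = (x₁⊗1 − σ₁(x₁)⊗1)·(1⊗x₂ − 1⊗σ₂(x₂)) and v = x₁ ⊗ σ₂(x₂) + σ₁(x₁) ⊗ x₂ lie in K₃, and u is a unit of K₃. Then, fixing any K₃-generator y ∈ K and defining s = ((y − τ₃(y))²)⁻¹·(Φ̃₁(y) − Φ̃₂(τ₃(y)))² and t = ((y − τ₃(y))²)⁻¹·(Φ̃₁(y)·Φ̃₂(y) − Φ̃₂(y)·Φ̃₁(y)) in C, one has s = u⁻¹·(w ⊗ 1 − v·1)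 and t = u⁻¹·(z ⊗ 1), where w ⊗ 1 and z ⊗ 1 denote the images of w and z under b ↦ b ⊗ 1 : B → C and K₃ acts centrally on C. -/
open TensorProduct

set_option synthInstance.maxHeartbeats 1000000
set_option maxHeartbeats 2000000

universe u

theorem core_sq {R C : Type*} [CommRing R] [Ring C] [Algebra R C] (P Ppr Q Qpr : C)
    (a b t n : R) (hQ : Q = algebraMap R C t - Qpr)
    (hPpr : Ppr = algebraMap R C (2 * a + b * t) - P)
    (hPP : P * Ppr = algebraMap R C (a ^ 2 + a * b * t + b ^ 2 * n))
    (hQQ : Qpr * Q = algebraMap R C n) :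
    (P - (algebraMap R C a + algebraMap R C b * Qpr)) ^ 2
      = algebraMap R C b * (P * Q + Qpr * Ppr - algebraMap R C (a * t + 2 * b * n)) := by
  subst hQ hPpr
  have h1 : P * P = (2 * a + b * t) • P - (a ^ 2 + a * b * t + b ^ 2 * n) • (1 : C) := by
    rw [← Algebra.algebraMap_eq_smul_one, ← hPP, mul_sub, ← Algebra.commutes, Algebra.smul_def]
    abel
  have h2 : Qpr * Qpr = t • Qpr - n • (1 : C) := by
    rw [← Algebra.algebraMap_eq_smul_one, ← hQQ, mul_sub, ← Algebra.commutes, Algebra.smul_def]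
    abel
  simp only [Algebra.algebraMap_eq_smul_one, pow_two (P - _), mul_sub, sub_mul, mul_add, add_mul,
    smul_mul_assoc, mul_smul_comm, one_mul, mul_one, h1, h2, smul_sub, smul_add]
  module

theorem core {R K C : Type*} [CommRing R] [CommRing K] [Ring C] [Algebra R C]
    (j : R →+* K) (f g : K →+* C) (τ : K →+* K)
    (hf : ∀ r, f (j r) = algebraMap R C r) (hg : ∀ r, g (j r) = algebraMap R C r)
    (hτ : ∀ k, τ (τ k) = k)
    (hj : ∀ r, τ (j r) = j r) (hfix : ∀ k, τ k = k → ∃ r, j r = k)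
    (p q y : K) (hp : IsUnit (p - τ p)) (hq : IsUnit (q - τ q)) :
    f ((p - τ p) * (q - τ q)) * (f y - g (τ y)) ^ 2
      = f ((y - τ y) ^ 2) * (f p * g q + g (τ q) * f (τ p) - f (p * τ q + τ p * q)) ∧
    f ((p - τ p) * (q - τ q)) * (f y * g y - g y * f y)
      = f ((y - τ y) ^ 2) * (f p * g q - g q * f p) := by
  have key : ∀ m l : K, IsUnit (m - τ m) → ∃ a b : R, l = j a + j b * m := by
    intro m l hm
    obtain ⟨e, he⟩ := hm.exists_right_inv
    have h1 : (m - τ m) * (e + τ e) = 0 := by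
      have := congrArg τ he
      simp only [map_mul, map_sub, hτ, map_one] at this
      linear_combination he - this
    have h2 : τ e = - e := by
      have := congrArg (e * ·) h1
      linear_combination this - (e + τ e) * he
    obtain ⟨b, hb⟩ := hfix ((l - τ l) * e) (by
      simp only [map_mul, map_sub, hτ, h2]; ring)
    obtain ⟨a, ha⟩ := hfix (l - j b * m) (by
      rw [map_sub, map_mul, hj, hb]
      linear_combination (l - τ l) * he)
    exact ⟨a, b, by rw [ha]; ring⟩
  obtain ⟨a, b, hy⟩ := key p y hp
  obtain ⟨apr, bpr, hpq⟩ := key q p hq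
  obtain ⟨t, ht⟩ := hfix (q + τ q) (by simp only [map_add, hτ]; ring)
  obtain ⟨n, hn⟩ := hfix (q * τ q) (by simp only [map_mul, hτ]; ring)
  obtain ⟨d, hd⟩ := hfix ((q - τ q) ^ 2) (by simp only [map_pow, map_sub, hτ]; ring)
  have hτp : τ p = j apr + j bpr * τ q := by
    conv_lhs => rw [hpq]
    simp only [map_add, map_mul, hj]
  have hτy : τ y = j a + j b * τ p := by
    rw [hy]; simp only [map_add, map_mul, hj]
  have e1 : (p - τ p) * (q - τ q) = j (bpr * d) := by
    rw [hτp, map_mul, hd]; linear_combination (q - τ q) * hpq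
  have e2 : (y - τ y) ^ 2 = j (b ^ 2 * bpr ^ 2 * d) := by
    have : y - τ y = j b * j bpr * (q - τ q) := by
      rw [hτy, hτp]; linear_combination hy + j b * hpq
    rw [this]; simp only [map_mul, map_pow, hd]; ring
  have e3 : p * τ q + τ p * q = j (apr * t + 2 * bpr * n) := by
    simp only [map_add, map_mul, ht, hn, hτp, map_ofNat]
    linear_combination τ q * hpq
  have hsq := core_sq (f p) (f (τ p)) (g q) (g (τ q)) apr bpr t n
    (by rw [← hg, ht, map_add]; abel)
    (by
      rw [← hf]
      have : j (2 * apr + bpr * t) = p + τ p := by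
        simp only [map_add, map_mul, ht, hτp, map_ofNat]
        linear_combination - hpq
      rw [this, map_add]; abel)
    (by
      rw [← hf, ← map_mul]
      congr 1
      simp only [map_add, map_mul, map_pow, ht, hn, hτp]
      linear_combination (j apr + j bpr * τ q) * hpq)
    (by rw [← hg, hn, ← map_mul, mul_comm])
  have g1 : g (τ p) = algebraMap R C apr + algebraMap R C bpr * g (τ q) := by
    rw [hτp, map_add, map_mul, hg, hg]
  have g2 : g p = algebraMap R C apr + algebraMap R C bpr * g q := by
    conv_lhs => rw [hpq]
    rw [map_add, map_mul, hg, hg]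
  have g3 : g (τ y) = algebraMap R C a + algebraMap R C b * g (τ p) := by
    rw [hτy, map_add, map_mul, hg, hg]
  have g4 : g y = algebraMap R C a + algebraMap R C b * g p := by
    rw [hy, map_add, map_mul, hg, hg]
  have g5 : f y = algebraMap R C a + algebraMap R C b * f p := by
    rw [hy, map_add, map_mul, hf, hf]
  rw [e1, e2, e3, hf, hf, hf]
  constructor
  · have : (f y - g (τ y)) ^ 2 = (b ^ 2) • (f p - g (τ p)) ^ 2 := by
      rw [g5, g3, add_sub_add_left_eq_sub, ← mul_sub, ← Algebra.smul_def, smul_pow]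
    rw [this, g1, hsq]
    simp only [← Algebra.smul_def, smul_smul]
    congr 1; ring
  · rw [g5, g4, g2]
    simp only [Algebra.algebraMap_eq_smul_one, mul_add, add_mul, mul_sub,
      smul_mul_assoc, mul_smul_comm, one_mul, mul_one, smul_sub, smul_add]
    module

theorem unit_gen (F : Type*) [Field F] (K : Type*) [CommRing K] [Algebra F K] [Algebra.Etale F K]
    (hdim : Module.finrank F K = 2) (σ : K ≃ₐ[F] K) (hσ : ∀ x, σ (σ x) = x)
    (hfix : ∀ x : K, σ x = x ↔ ∃ a : F, algebraMap F K a = x)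
    (x : K) (hx : ∀ k : K, ∃ a b : F, k = algebraMap F K a + algebraMap F K b * x) :
    IsUnit (x - σ x) := by
  obtain ⟨a, ha⟩ := (hfix ((x - σ x) ^ 2)).1 (by simp only [map_pow, map_sub, hσ]; ring)
  by_cases h0 : a = 0
  · exfalso
    have : IsReduced K := Algebra.FormallyUnramified.isReduced_of_field F K
    rw [h0, map_zero] at ha
    have h1 : x - σ x = 0 := pow_eq_zero_iff (two_ne_zero) |>.1 ha.symm
    obtain ⟨c, hc⟩ := (hfix x).1 (sub_eq_zero.1 h1).symm
    have h2 : Module.finrank F K ≤ 1 := by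
      refine finrank_le_one (1 : K) fun k => ?_
      obtain ⟨r, s, hk⟩ := hx k
      refine ⟨r + s * c, ?_⟩
      rw [hk, ← hc, ← Algebra.algebraMap_eq_smul_one]; simp
    omega
  · have : IsUnit ((x - σ x) ^ 2) := by
      rw [← ha]; exact (isUnit_iff_ne_zero.2 h0).map _
    exact (isUnit_pow_iff two_ne_zero).1 this

/-- Expression of `s` and `t` in terms of the elements
`w = Φ₁(x₁)Φ₂(x₂) + Φ₂(σ₂ x₂)Φ₁(σ₁ x₁)` and `z = Φ₁(x₁)Φ₂(x₂) − Φ₂(x₂)Φ₁(x₁)`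
of `B`:  with `u = (x₁⊗1 − σ₁(x₁)⊗1)(1⊗x₂ − 1⊗σ₂(x₂))` and
`v = x₁ ⊗ σ₂(x₂) + σ₁(x₁) ⊗ x₂`, one has `u, v ∈ K₃`, `u` a unit of `K₃`,
`s = u⁻¹·(w ⊗ 1 − v·1)` and `t = u⁻¹·(z ⊗ 1)`. -/
theorem s_t_in_terms_of_w_z
    (F : Type u) [Field F] (K₁ K₂ : Type u)
    [CommRing K₁] [CommRing K₂] [Algebra F K₁] [Algebra F K₂]
    [Algebra.Etale F K₁] [Algebra.Etale F K₂]
    (hdim₁ : Module.finrank F K₁ = 2) (hdim₂ : Module.finrank F K₂ = 2)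
    (σ₁ : K₁ ≃ₐ[F] K₁) (σ₂ : K₂ ≃ₐ[F] K₂)
    (hσ₁ : ∀ x : K₁, σ₁ (σ₁ x) = x) (hσ₂ : ∀ x : K₂, σ₂ (σ₂ x) = x)
    (hσ₁fix : ∀ x : K₁, σ₁ x = x ↔ ∃ a : F, algebraMap F K₁ a = x)
    (hσ₂fix : ∀ x : K₂, σ₂ x = x ↔ ∃ a : F, algebraMap F K₂ a = x)
    (h : ℕ) (hh : 0 < h)
    (B : Type u) [Ring B] [Algebra F B] [FiniteDimensional F B]
    [Algebra.IsCentral F B] [IsSimpleRing B]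
    (hB : Module.finrank F B = 4 * h ^ 2)
    (Φ₁ : K₁ →ₐ[F] B) (Φ₂ : K₂ →ₐ[F] B)
    -- `Φ̃₁, Φ̃₂ : K → C = B ⊗[F] K₃`, the unique `K₃`-algebra extensions of `Φ₁, Φ₂`
    (Φt₁ Φt₂ : (K₁ ⊗[F] K₂) →ₐ[F] B ⊗[F] (K3 σ₁ σ₂))
    (hΦt₁ : ∀ x : K₁, Φt₁ (x ⊗ₜ[F] (1 : K₂)) = Φ₁ x ⊗ₜ[F] (1 : K3 σ₁ σ₂))
    (hΦt₂ : ∀ x : K₂, Φt₂ ((1 : K₁) ⊗ₜ[F] x) = Φ₂ x ⊗ₜ[F] (1 : K3 σ₁ σ₂))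
    (hΦt₁c : ∀ c : K3 σ₁ σ₂, Φt₁ (c : K₁ ⊗[F] K₂) = (1 : B) ⊗ₜ[F] c)
    (hΦt₂c : ∀ c : K3 σ₁ σ₂, Φt₂ (c : K₁ ⊗[F] K₂) = (1 : B) ⊗ₜ[F] c)
    -- `F`-algebra generators `x₁` of `K₁` and `x₂` of `K₂`
    (x₁ : K₁) (hx₁ : ∀ k : K₁, ∃ a b : F, k = algebraMap F K₁ a + algebraMap F K₁ b * x₁)
    (x₂ : K₂) (hx₂ : ∀ k : K₂, ∃ a b : F, k = algebraMap F K₂ a + algebraMap F K₂ b * x₂) :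
    let w : B := Φ₁ x₁ * Φ₂ x₂ + Φ₂ (σ₂ x₂) * Φ₁ (σ₁ x₁)
    let z : B := Φ₁ x₁ * Φ₂ x₂ - Φ₂ x₂ * Φ₁ x₁
    let u : K₁ ⊗[F] K₂ :=
      (x₁ ⊗ₜ[F] (1 : K₂) - σ₁ x₁ ⊗ₜ[F] (1 : K₂)) *
        ((1 : K₁) ⊗ₜ[F] x₂ - (1 : K₁) ⊗ₜ[F] σ₂ x₂)
    let v : K₁ ⊗[F] K₂ := x₁ ⊗ₜ[F] σ₂ x₂ + σ₁ x₁ ⊗ₜ[F] x₂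
    u ∈ K3 σ₁ σ₂ ∧ v ∈ K3 σ₁ σ₂ ∧
    (∃ u₃ : (K3 σ₁ σ₂)ˣ, ((u₃ : K3 σ₁ σ₂) : K₁ ⊗[F] K₂) = u) ∧
    (∀ y : K₁ ⊗[F] K₂,
      (∀ k : K₁ ⊗[F] K₂, ∃ a b : K3 σ₁ σ₂,
        k = (a : K₁ ⊗[F] K₂) + (b : K₁ ⊗[F] K₂) * y) →
      IsUnit (y - tau3 σ₁ σ₂ y) →
      Ring.inverse (Φt₁ ((y - tau3 σ₁ σ₂ y) ^ 2)) * (Φt₁ y - Φt₂ (tau3 σ₁ σ₂ y)) ^ 2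
          = Ring.inverse (Φt₁ u) * (w ⊗ₜ[F] (1 : K3 σ₁ σ₂) - Φt₁ v) ∧
      Ring.inverse (Φt₁ ((y - tau3 σ₁ σ₂ y) ^ 2)) * (Φt₁ y * Φt₂ y - Φt₂ y * Φt₁ y)
          = Ring.inverse (Φt₁ u) * (z ⊗ₜ[F] (1 : K3 σ₁ σ₂))) := by
  intro w z u v
  have hd₁ := unit_gen F K₁ hdim₁ σ₁ hσ₁ hσ₁fix x₁ hx₁
  have hd₂ := unit_gen F K₂ hdim₂ σ₂ hσ₂ hσ₂fix x₂ hx₂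
  have hmem : ∀ k, k ∈ K3 σ₁ σ₂ ↔ tau3 σ₁ σ₂ k = k := fun k => Iff.rfl
  have hτt : ∀ a b, tau3 σ₁ σ₂ (a ⊗ₜ[F] b) = σ₁ a ⊗ₜ[F] σ₂ b := fun a b => rfl
  have hττ : ∀ k, tau3 σ₁ σ₂ (tau3 σ₁ σ₂ k) = k := by
    intro k
    induction k with
    | zero => simp
    | tmul a b => rw [hτt, hτt, hσ₁, hσ₂]
    | add a b ha hb => rw [map_add, map_add, ha, hb]
  have hu : u ∈ K3 σ₁ σ₂ := by
    rw [hmem]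
    simp only [u, map_mul, map_sub, hτt, hσ₁, hσ₂, map_one]
    ring
  have hv : v ∈ K3 σ₁ σ₂ := by
    rw [hmem]
    simp only [v, map_add, hτt, hσ₁, hσ₂]
    ring
  have hp : IsUnit (x₁ ⊗ₜ[F] (1 : K₂) - σ₁ x₁ ⊗ₜ[F] (1 : K₂)) := by
    rw [← TensorProduct.sub_tmul]
    exact hd₁.map (Algebra.TensorProduct.includeLeft : K₁ →ₐ[F] K₁ ⊗[F] K₂)
  have hq : IsUnit ((1 : K₁) ⊗ₜ[F] x₂ - (1 : K₁) ⊗ₜ[F] σ₂ x₂) := by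
    rw [← TensorProduct.tmul_sub]
    exact hd₂.map (Algebra.TensorProduct.includeRight : K₂ →ₐ[F] K₁ ⊗[F] K₂)
  have huu : IsUnit u := hp.mul hq
  refine ⟨hu, hv, ?_, ?_⟩
  · obtain ⟨e, he⟩ := huu.exists_right_inv
    have hτe : tau3 σ₁ σ₂ e = e := by
      have h1 := congrArg (tau3 σ₁ σ₂) he
      rw [map_mul, (hmem u).1 hu, map_one] at h1
      exact huu.mul_left_cancel (h1.trans he.symm)
    refine ⟨⟨⟨u, hu⟩, ⟨e, (hmem e).2 hτe⟩, Subtype.ext he, Subtype.ext ?_⟩, rfl⟩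
    exact (mul_comm e u).trans he
  · intro y _ hy
    letI : Algebra (K3 σ₁ σ₂) (B ⊗[F] (K3 σ₁ σ₂)) := Algebra.TensorProduct.rightAlgebra
    have hτp : tau3 σ₁ σ₂ (x₁ ⊗ₜ[F] (1 : K₂)) = σ₁ x₁ ⊗ₜ[F] (1 : K₂) := by rw [hτt, map_one]
    have hτq : tau3 σ₁ σ₂ ((1 : K₁) ⊗ₜ[F] x₂) = (1 : K₁) ⊗ₜ[F] σ₂ x₂ := by rw [hτt, map_one]
    have H := core (R := K3 σ₁ σ₂) (K3 σ₁ σ₂).val.toRingHom Φt₁.toRingHom Φt₂.toRingHom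
      (tau3 σ₁ σ₂).toAlgHom.toRingHom hΦt₁c hΦt₂c hττ (fun r => r.2) (fun k hk => ⟨⟨k, hk⟩, rfl⟩)
      (x₁ ⊗ₜ[F] (1 : K₂)) ((1 : K₁) ⊗ₜ[F] x₂) y
      (by change IsUnit (_ - tau3 σ₁ σ₂ _); rw [hτp]; exact hp)
      (by change IsUnit (_ - tau3 σ₁ σ₂ _); rw [hτq]; exact hq)
    change Φt₁ ((_ - tau3 σ₁ σ₂ _) * (_ - tau3 σ₁ σ₂ _)) * (Φt₁ _ - Φt₂ (tau3 σ₁ σ₂ _)) ^ 2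
      = Φt₁ ((_ - tau3 σ₁ σ₂ _) ^ 2) * (Φt₁ _ * Φt₂ _ + Φt₂ (tau3 σ₁ σ₂ _) * Φt₁ (tau3 σ₁ σ₂ _)
        - Φt₁ (_ * tau3 σ₁ σ₂ _ + tau3 σ₁ σ₂ _ * _)) ∧
      Φt₁ ((_ - tau3 σ₁ σ₂ _) * (_ - tau3 σ₁ σ₂ _)) * (Φt₁ _ * Φt₂ _ - Φt₂ _ * Φt₁ _)
      = Φt₁ ((_ - tau3 σ₁ σ₂ _) ^ 2) * (Φt₁ _ * Φt₂ _ - Φt₂ _ * Φt₁ _) at H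
    rw [hτp, hτq, hΦt₁, hΦt₁, hΦt₂, hΦt₂] at H
    simp only [Algebra.TensorProduct.tmul_mul_tmul, one_mul, mul_one,
      ← TensorProduct.add_tmul, ← TensorProduct.sub_tmul] at H
    have hU : IsUnit (Φt₁ u) := huu.map Φt₁
    have hD : IsUnit (Φt₁ ((y - tau3 σ₁ σ₂ y) ^ 2)) := (hy.pow 2).map Φt₁
    have hUD : Φt₁ u * Φt₁ ((y - tau3 σ₁ σ₂ y) ^ 2) = Φt₁ ((y - tau3 σ₁ σ₂ y) ^ 2) * Φt₁ u := by
      rw [← map_mul, ← map_mul, mul_comm]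
    have fin : ∀ m l : B ⊗[F] (K3 σ₁ σ₂),
        Φt₁ u * m = Φt₁ ((y - tau3 σ₁ σ₂ y) ^ 2) * l →
        Ring.inverse (Φt₁ ((y - tau3 σ₁ σ₂ y) ^ 2)) * m = Ring.inverse (Φt₁ u) * l := by
      intro m l hml
      apply (hU.mul hD).mul_left_cancel
      rw [mul_assoc, Ring.mul_inverse_cancel_left _ _ hD, hml, hUD, mul_assoc,
        Ring.mul_inverse_cancel_left _ _ hU]
    refine ⟨fin _ _ ?_, fin _ _ ?_⟩
    · convert H.1 using 3
      all_goals simp only [u, v, w, ← TensorProduct.sub_tmul, ← TensorProduct.tmul_sub, Algebra.TensorProduct.tmul_mul_tmul, one_mul, mul_one]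
    · convert H.2 using 3
      all_goals simp only [u, ← TensorProduct.sub_tmul, ← TensorProduct.tmul_sub, Algebra.TensorProduct.tmul_mul_tmul, one_mul, mul_one]
end

section
/- Let x₁ ∈ K₁ and x₂ ∈ K₂ be F-algebra generators (K₁ = F + F·x₁ and K₂ = F + F·x₂), and set w = Φ₁(x₁)·Φ₂(x₂) + Φ₂(σ₂(x₂))·Φ₁(σ₁(x₁)) and z = Φ₁(x₁)·Φ₂(x₂) − Φ₂(x₂)·Φ₁(x₁) in B. Then: (i) w·z = z·w; (ii) w·Φᵢ(x) = Φᵢ(x)·w and z·Φᵢ(x) = Φᵢ(σᵢ(x))·z for all x ∈ Kᵢ and both i = 1, 2; (iii) z² = w² − Tr_{K₁/F}(x₁)·Tr_{K₂/F}(x₂)·w + (Tr_{K₁/F}(x₁²)·Nm_{K₂/F}(x₂) + Tr_{K₂/F}(x₂²)·Nm_{K₁/F}(x₁))·1_B, where Tr_{Kᵢ/F} and Nm_{Kᵢ/F} denote the algebra trace and norm of the 2-dimensional F-algebra Kᵢ. -/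
universe u

theorem quad_aux (F : Type u) [Field F] (K : Type u) [CommRing K] [Algebra F K]
    (hdim : Module.finrank F K = 2) (σ : K ≃ₐ[F] K) (hσ : ∀ x : K, σ (σ x) = x)
    (hfix : ∀ x : K, σ x = x ↔ ∃ a : F, algebraMap F K a = x)
    (x : K) (hx : ∀ k : K, ∃ a b : F, k = algebraMap F K a + algebraMap F K b * x) :
    ∃ t n : F, x * x = t • x - n • (1 : K) ∧ σ x = t • (1 : K) - x ∧ Algebra.trace F K x = t ∧
      Algebra.norm F x = n ∧ Algebra.trace F K (x ^ 2) = t * t - 2 * n := by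
  obtain ⟨t, ht⟩ := (hfix (x + σ x)).1 (by rw [map_add, hσ, add_comm])
  obtain ⟨n, hn⟩ := (hfix (x * σ x)).1 (by rw [map_mul, hσ, mul_comm])
  have hs : σ x = t • (1 : K) - x := by
    rw [← Algebra.algebraMap_eq_smul_one, ht]; ring
  have hxx : x * x = t • x - n • (1 : K) := by
    rw [← Algebra.algebraMap_eq_smul_one, Algebra.smul_def, ht, hn]; ring
  have hspan : ⊤ ≤ Submodule.span F (Set.range ![(1 : K), x]) := by
    intro k _
    obtain ⟨a, b, rfl⟩ := hx k
    rw [← Algebra.smul_def, Algebra.algebraMap_eq_smul_one]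
    refine add_mem (Submodule.smul_mem _ _ (Submodule.subset_span ⟨0, rfl⟩))
      (Submodule.smul_mem _ _ (Submodule.subset_span ⟨1, rfl⟩))
  let b : Module.Basis (Fin 2) F K := basisOfTopLeSpanOfCardEqFinrank ![(1 : K), x] hspan (by simp [hdim])
  have b0 : b 0 = 1 := by simp [b]
  have b1 : b 1 = x := by simp [b]
  have hM : Algebra.leftMulMatrix b x = !![0, -n; 1, t] := by
    ext i j
    rw [Algebra.leftMulMatrix_eq_repr_mul]
    have e0 : x * b 0 = b 1 := by rw [b0, b1, mul_one]
    have e1 : x * b 1 = t • b 1 - n • b 0 := by rw [b0, b1, hxx]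
    fin_cases j
    · simp only [Fin.zero_eta, e0]
      fin_cases i <;> simp
    · simp only [Fin.mk_one, e1]
      fin_cases i <;> simp
  have htr : Algebra.trace F K x = t := by
    rw [Algebra.trace_eq_matrix_trace b, hM]; simp [Matrix.trace_fin_two]
  refine ⟨t, n, hxx, hs, htr, ?_, ?_⟩
  · rw [Algebra.norm_eq_matrix_det b, hM]; simp [Matrix.det_fin_two]
  · rw [Algebra.trace_eq_matrix_trace b, map_pow, hM]
    simp [Matrix.trace_fin_two, pow_two]; ring

theorem alg_aux (F : Type u) [Field F] (B : Type u) [Ring B] [Algebra F B] (X Y : B)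
    (t n s m : F) (hX : X * X = t • X - n • (1 : B)) (hY : Y * Y = s • Y - m • (1 : B)) (w z : B)
    (hw : w = X * Y + (s • (1 : B) - Y) * (t • (1 : B) - X)) (hz : z = X * Y - Y * X) :
    w * z = z * w ∧ w * X = X * w ∧ z * X = (t • (1 : B) - X) * z ∧
    w * Y = Y * w ∧ z * Y = (s • (1 : B) - Y) * z ∧
    z ^ 2 = w ^ 2 - (t * s) • w + ((t * t - 2 * n) * m + (s * s - 2 * m) * n) • (1 : B) := by
  have hX' : ∀ A : B, X * (X * A) = t • (X * A) - n • A := fun A => by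
    rw [← mul_assoc, hX, sub_mul, smul_mul_assoc, smul_mul_assoc, one_mul]
  have hY' : ∀ A : B, Y * (Y * A) = s • (Y * A) - m • A := fun A => by
    rw [← mul_assoc, hY, sub_mul, smul_mul_assoc, smul_mul_assoc, one_mul]
  subst hw hz
  refine ⟨?_, ?_, ?_, ?_, ?_, ?_⟩ <;>
  · simp only [pow_two, mul_add, add_mul, mul_sub, sub_mul, smul_mul_assoc, mul_smul_comm, one_mul,
      mul_one, mul_assoc, hX, hY, hX', hY', smul_sub, smul_add]
    module

/-- Properties of the elements `w = Φ₁(x₁)Φ₂(x₂) + Φ₂(σ₂ x₂)Φ₁(σ₁ x₁)` and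
`z = Φ₁(x₁)Φ₂(x₂) − Φ₂(x₂)Φ₁(x₁)` of `B`:  they commute, `w` centralizes
the images of `Φ₁` and `Φ₂` while `z` intertwines them with their Galois
conjugates, and `z² = w² − Tr(x₁)Tr(x₂)·w + (Tr(x₁²)Nm(x₂) + Tr(x₂²)Nm(x₁))·1`. -/
theorem w_z_properties
    (F : Type u) [Field F] (K₁ K₂ : Type u)
    [CommRing K₁] [CommRing K₂] [Algebra F K₁] [Algebra F K₂]
    [Algebra.Etale F K₁] [Algebra.Etale F K₂]
    (hdim₁ : Module.finrank F K₁ = 2) (hdim₂ : Module.finrank F K₂ = 2)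
    (σ₁ : K₁ ≃ₐ[F] K₁) (σ₂ : K₂ ≃ₐ[F] K₂)
    (hσ₁ : ∀ x : K₁, σ₁ (σ₁ x) = x) (hσ₂ : ∀ x : K₂, σ₂ (σ₂ x) = x)
    (hσ₁fix : ∀ x : K₁, σ₁ x = x ↔ ∃ a : F, algebraMap F K₁ a = x)
    (hσ₂fix : ∀ x : K₂, σ₂ x = x ↔ ∃ a : F, algebraMap F K₂ a = x)
    (h : ℕ) (hh : 0 < h)
    (B : Type u) [Ring B] [Algebra F B] [FiniteDimensional F B]
    [Algebra.IsCentral F B] [IsSimpleRing B]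
    (hB : Module.finrank F B = 4 * h ^ 2)
    (Φ₁ : K₁ →ₐ[F] B) (Φ₂ : K₂ →ₐ[F] B)
    -- `F`-algebra generators `x₁` of `K₁` and `x₂` of `K₂`
    (x₁ : K₁) (hx₁ : ∀ k : K₁, ∃ a b : F, k = algebraMap F K₁ a + algebraMap F K₁ b * x₁)
    (x₂ : K₂) (hx₂ : ∀ k : K₂, ∃ a b : F, k = algebraMap F K₂ a + algebraMap F K₂ b * x₂) :
    let w : B := Φ₁ x₁ * Φ₂ x₂ + Φ₂ (σ₂ x₂) * Φ₁ (σ₁ x₁)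
    let z : B := Φ₁ x₁ * Φ₂ x₂ - Φ₂ x₂ * Φ₁ x₁
    (w * z = z * w) ∧
    (∀ x : K₁, w * Φ₁ x = Φ₁ x * w ∧ z * Φ₁ x = Φ₁ (σ₁ x) * z) ∧
    (∀ x : K₂, w * Φ₂ x = Φ₂ x * w ∧ z * Φ₂ x = Φ₂ (σ₂ x) * z) ∧
    z ^ 2 = w ^ 2 - (Algebra.trace F K₁ x₁ * Algebra.trace F K₂ x₂) • w
      + (Algebra.trace F K₁ (x₁ ^ 2) * Algebra.norm F x₂
          + Algebra.trace F K₂ (x₂ ^ 2) * Algebra.norm F x₁) • (1 : B) := by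
  intro w z
  obtain ⟨t, n, hxx, hs, ht, hn, ht2⟩ := quad_aux F K₁ hdim₁ σ₁ hσ₁ hσ₁fix x₁ hx₁
  obtain ⟨s, m, hyy, hs', hs1, hm, hs2⟩ := quad_aux F K₂ hdim₂ σ₂ hσ₂ hσ₂fix x₂ hx₂
  obtain ⟨h1, h2, h3, h4, h5, h6⟩ := alg_aux F B (Φ₁ x₁) (Φ₂ x₂) t n s m
    (by rw [← map_mul, hxx]; simp) (by rw [← map_mul, hyy]; simp) w z
    (by simp [w, hs, hs']) rfl
  rw [ht, hn, ht2, hs1, hm, hs2]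
  refine ⟨h1, fun x => ?_, fun x => ?_, h6⟩
  · obtain ⟨a, b, rfl⟩ := hx₁ x
    simp only [map_add, map_mul, AlgEquiv.commutes, AlgHom.commutes, hs, map_sub, map_smul, map_one,
      ← Algebra.smul_def, Algebra.algebraMap_eq_smul_one, mul_add, add_mul, mul_smul_comm,
      smul_mul_assoc, mul_one, one_mul, h2, h3, and_self]
  · obtain ⟨a, b, rfl⟩ := hx₂ x
    simp only [map_add, map_mul, AlgEquiv.commutes, AlgHom.commutes, hs', map_sub, map_smul, map_one,
      ← Algebra.smul_def, Algebra.algebraMap_eq_smul_one, mul_add, add_mul, mul_smul_comm,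
      smul_mul_assoc, mul_one, one_mul, h4, h5, and_self]
end

section
/- Fix a K₃-generator y ∈ K and let s = ((y − τ₃(y))²)⁻¹ · (Φ̃₁(y) − Φ̃₂(τ₃(y)))² ∈ M_{2h}(K₃), and let Q ∈ K₃[T] be a monic polynomial of degree h with Q² = charpoly(s). Then the following are equivalent: (a) s is a unit of M_{2h}(K₃) and the K₃-subalgebra K₃[s] generated by s is étale over K₃ and free of rank h as a K₃-module; (b) for every F-algebra homomorphism ρ : K₃ → F̄ into an algebraic closure F̄ of F, the polynomial Q^ρ ∈ F̄[T] obtained by applying ρ to the coefficients of Q has h distinct nonzero roots, i.e. Q^ρ is separable and Q^ρ(0) ≠ 0. -/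
open TensorProduct

set_option synthInstance.maxHeartbeats 1000000
set_option maxHeartbeats 2000000

universe u

theorem aux_scalar {k V : Type*} [Field k] [AddCommGroup V] [Module k V]
    (A N : Module.End k V) (t n : k) (hA : A * A = t • A - n • 1) (hd : t ^ 2 - 4 * n ≠ 0)
    (hc : A * N = N * A) (w : V) (hw : LinearIndependent k ![w, N w]) (hN : N (N w) = 0)
    (hspan : A w ∈ Submodule.span k {w, N w}) : ∃ x : k, A w = x • w := by
  obtain ⟨x, c, hx⟩ := Submodule.mem_span_pair.1 hspan
  have h1 : A (N w) = x • N w := by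
    have := congrArg (fun f => f w) hc
    simp only [Module.End.mul_apply] at this
    rw [this, ← hx]; simp [hN]
  have h2 := congrArg (fun f => f w) hA
  simp only [Module.End.mul_apply, LinearMap.sub_apply, LinearMap.smul_apply,
    Module.End.one_apply] at h2
  rw [← hx] at h2
  simp only [map_add, map_smul, h1, ← hx] at h2
  have h3 : (x * x - t * x + n) • w + (x * c + c * x - t * c) • N w = 0 := by
    rw [← sub_eq_zero] at h2
    rw [← h2]; module
  have h4 := LinearIndependent.pair_iff.1 hw _ _ h3
  have hc0 : c = 0 := by
    by_contra hne
    have h5 : 2 * x - t = 0 := by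
      apply mul_left_cancel₀ hne
      linear_combination h4.2
    apply hd
    linear_combination (2 * x - t) * h5 - 4 * h4.1
  exact ⟨x, by rw [← hx, hc0]; simp⟩

theorem aux_comm {k E : Type*} [CommRing k] [Ring E] [Algebra k E]
    (A B : E) (t n : k) (hA : A * A = t • A - n • 1) (hB : B * B = t • B - n • 1) :
    A * ((A - B) * (A - B)) = ((A - B) * (A - B)) * A := by
  have e1 : A * (A * A) = A * A * A := (mul_assoc _ _ _).symm
  have h1 : (A - B) * (A - B) = A * A - A * B - B * A + B * B := by noncomm_ring
  rw [h1, hB]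
  have h2 : A * A * B = t • (A * B) - n • B := by rw [hA]; simp [sub_mul]
  have h3 : B * A * A = t • (B * A) - n • B := by rw [mul_assoc, hA]; simp [mul_sub]
  simp only [mul_add, mul_sub, add_mul, sub_mul, mul_smul_comm, smul_mul_assoc, mul_one, one_mul,
    ← mul_assoc, h2, h3]
  abel

theorem aux_field {k V : Type*} [Field k] [IsAlgClosed k] [AddCommGroup V] [Module k V]
    [FiniteDimensional k V] (A B S : Module.End k V) (t n d : k)
    (hA : A * A = t • A - n • 1) (hB : B * B = t • B - n • 1) (hd : t ^ 2 - 4 * n ≠ 0)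
    (hS : S = d • ((A - B) * (A - B))) (Q : Polynomial k) (hQ : Q ^ 2 = S.charpoly)
    (hsep : Q.Separable) : Polynomial.aeval S Q = 0 := by
  have hQ0 : Q ≠ 0 := hsep.ne_zero
  have cA : Commute A S := by
    rw [Commute, SemiconjBy, hS, mul_smul_comm, smul_mul_assoc, aux_comm A B t n hA hB]
  have cB : Commute B S := by
    have : (A - B) * (A - B) = (B - A) * (B - A) := by noncomm_ring
    rw [Commute, SemiconjBy, hS, mul_smul_comm, smul_mul_assoc, this, aux_comm B A t n hB hA]
  have key : ∀ μ : k, ∀ v ∈ S.maxGenEigenspace μ, S v = μ • v := by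
    intro μ v hv
    set N : Module.End k V := S - μ • 1 with hNdef
    have cAN : A * N = N * A := by
      simp only [hNdef, mul_sub, sub_mul, mul_smul_comm, smul_mul_assoc, mul_one, one_mul, cA.eq]
    have cBN : B * N = N * B := by
      simp only [hNdef, mul_sub, sub_mul, mul_smul_comm, smul_mul_assoc, mul_one, one_mul, cB.eq]
    have hW : Module.finrank k (S.maxGenEigenspace μ) ≤ 2 := by
      rw [LinearMap.finrank_maxGenEigenspace_eq, ← hQ, pow_two,
        Polynomial.rootMultiplicity_mul (mul_ne_zero hQ0 hQ0)]
      have := Polynomial.rootMultiplicity_le_one_of_separable hsep μ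
      omega
    by_contra hne
    have hex : ∃ j, (N ^ j) v = 0 := (Module.End.mem_maxGenEigenspace S μ v).1 hv
    classical
    obtain ⟨j, hj⟩ : ∃ j, Nat.find hex = j + 2 := by
      refine ⟨Nat.find hex - 2, ?_⟩
      have h0 : Nat.find hex ≠ 0 := by
        intro h
        have := Nat.find_spec hex
        rw [h] at this
        apply hne
        simp at this
        simp [this]
      have h1 : Nat.find hex ≠ 1 := by
        intro h
        have := Nat.find_spec hex
        rw [h] at this
        apply hne
        simp [hNdef] at this
        exact sub_eq_zero.1 this
      omega
    set w := (N ^ j) v with hw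
    have hNw : N w ≠ 0 := by
      rw [hw, ← Module.End.mul_apply, ← pow_succ']
      exact Nat.find_min hex (by omega)
    have hNNw : N (N w) = 0 := by
      have := Nat.find_spec hex
      rw [hj, pow_succ', pow_succ'] at this
      exact this
    have hSN : Commute S N := by
      simp only [Commute, SemiconjBy, hNdef, mul_sub, sub_mul, mul_smul_comm, smul_mul_assoc, mul_one, one_mul]
    have hwW : w ∈ S.maxGenEigenspace μ :=
      Module.End.mapsTo_maxGenEigenspace_of_comm (hSN.pow_right j) μ hv
    have hNwW : N w ∈ S.maxGenEigenspace μ :=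
      Module.End.mapsTo_maxGenEigenspace_of_comm hSN μ hwW
    have hli : LinearIndependent k ![w, N w] := by
      rw [LinearIndependent.pair_iff]
      intro a b hab
      have h1 := congrArg N hab
      simp only [map_add, map_smul, hNNw, smul_zero, add_zero, map_zero] at h1
      have ha : a = 0 := (smul_eq_zero.1 h1).resolve_right hNw
      rw [ha, zero_smul, zero_add] at hab
      exact ⟨ha, (smul_eq_zero.1 hab).resolve_right hNw⟩
    have hsp : Submodule.span k {w, N w} = S.maxGenEigenspace μ := by
      apply Submodule.eq_of_le_of_finrank_le
      · rw [Submodule.span_le]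
        rintro z (rfl | rfl)
        · exact hwW
        · exact hNwW
      · have := finrank_span_eq_card hli
        rw [show Set.range ![w, N w] = {w, N w} by
          simp [Matrix.range_cons, Set.pair_comm], Fintype.card_fin] at this
        omega
    obtain ⟨x, hx⟩ := aux_scalar A N t n hA hd cAN w hli hNNw (by
      rw [hsp]; exact Module.End.mapsTo_maxGenEigenspace_of_comm cA.symm μ hwW)
    obtain ⟨x', hx'⟩ := aux_scalar B N t n hB hd cBN w hli hNNw (by
      rw [hsp]; exact Module.End.mapsTo_maxGenEigenspace_of_comm cB.symm μ hwW)
    have hNs : N w = (d * (x - x') * (x - x') - μ) • w := by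
      have hab : (A - B) w = (x - x') • w := by rw [LinearMap.sub_apply, hx, hx', sub_smul]
      rw [hNdef, hS, LinearMap.sub_apply, LinearMap.smul_apply, Module.End.mul_apply, hab,
        map_smul, hab, LinearMap.smul_apply, Module.End.one_apply]
      module
    have := LinearIndependent.pair_iff.1 hli (d * (x - x') * (x - x') - μ) (-1) (by
      rw [hNs]; module)
    simp at this
  rw [← LinearMap.ker_eq_top, eq_top_iff, ← Module.End.iSup_maxGenEigenspace_eq_top S]
  refine iSup_le fun μ v hv => ?_
  rw [LinearMap.mem_ker]
  by_cases hv0 : v = 0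
  · simp [hv0]
  have hev : Module.End.HasEigenvector S μ v :=
    ⟨Module.End.mem_eigenspace_iff.2 (key μ v hv), hv0⟩
  rw [Module.End.aeval_apply_of_hasEigenvector hev]
  have hroot : S.charpoly.IsRoot μ :=
    (Module.End.hasEigenvalue_iff_isRoot_charpoly S μ).1 (Module.End.hasEigenvalue_of_hasEigenvector hev)
  rw [← hQ, Polynomial.IsRoot, Polynomial.eval_pow] at hroot
  rw [pow_eq_zero_iff two_ne_zero |>.1 hroot, zero_smul]

/-- matrix version, together with divisibility -/
theorem aux_matrix {k : Type*} [Field k] [IsAlgClosed k] {m : ℕ}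
    (A B S : Matrix (Fin m) (Fin m) k) (t n d : k)
    (hA : A * A = t • A - n • 1) (hB : B * B = t • B - n • 1) (hd : t ^ 2 - 4 * n ≠ 0)
    (hS : S = d • ((A - B) * (A - B))) (Q : Polynomial k) (hQ : Q ^ 2 = S.charpoly)
    (hsep : Q.Separable) : Polynomial.aeval S Q = 0 := by
  let e := Matrix.toLinAlgEquiv' (R := k) (n := Fin m)
  apply e.injective
  rw [map_zero, ← Polynomial.aeval_algHom_apply]
  refine aux_field (e A) (e B) (e S) t n d ?_ ?_ hd ?_ Q ?_ hsep
  · rw [← map_mul, hA]; simp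
  · rw [← map_mul, hB]; simp
  · rw [hS]; simp
  · rw [hQ]; exact (Matrix.charpoly_toLin' S).symm

theorem aux_dvd {k : Type*} [Field k] [IsAlgClosed k] {m : ℕ}
    (S : Matrix (Fin m) (Fin m) k) (Q P : Polynomial k) (hQ : Q ^ 2 = S.charpoly)
    (hsep : Q.Separable) (hP : Polynomial.aeval S P = 0) : Q ∣ P := by
  by_cases hP0 : P = 0
  · simp [hP0]
  refine (IsAlgClosed.splits Q).dvd_of_roots_le_roots hsep.ne_zero ?_
  rw [Multiset.le_iff_subset (Polynomial.nodup_roots hsep)]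
  intro μ hμ
  have hμ' : Q.eval μ = 0 := (Polynomial.mem_roots'.1 hμ).2
  have hroot : (Matrix.toLin' S).charpoly.IsRoot μ := by
    rw [Matrix.charpoly_toLin', ← hQ]
    simp [hμ']
  obtain ⟨v, hv⟩ :=
    ((Module.End.hasEigenvalue_iff_isRoot_charpoly (Matrix.toLin' S) μ).2 hroot).exists_hasEigenvector
  have h1 := Module.End.aeval_apply_of_hasEigenvector (p := P) hv
  have h2 : Polynomial.aeval (Matrix.toLin' S) P = 0 := by
    have := Polynomial.aeval_algHom_apply (Matrix.toLinAlgEquiv' (R := k) (n := Fin m)) S P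
    rw [hP, map_zero] at this
    exact this
  rw [h2, LinearMap.zero_apply] at h1
  exact (Polynomial.mem_roots hP0).2 ((smul_eq_zero.1 h1.symm).resolve_right hv.2)

/-- Nonunit detection. -/
theorem aux_unit_s10 {F S : Type*} [Field F] [CommRing S] [Algebra F S] [Module.Finite F S]
    (x : S) (hx : ∀ φ : S →ₐ[F] AlgebraicClosure F, φ x ≠ 0) : IsUnit x := by
  by_contra hne
  obtain ⟨M, hM, hxM⟩ := exists_max_ideal_of_mem_nonunits hne
  let _ := Ideal.Quotient.field M
  have : Module.Finite F (S ⧸ M) := inferInstance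
  let φ : (S ⧸ M) →ₐ[F] AlgebraicClosure F := IsAlgClosed.lift
  exact hx (φ.comp (Ideal.Quotient.mkₐ F M)) (by
    simp [Ideal.Quotient.eq_zero_iff_mem.2 hxM])

theorem aux_zero {F S : Type*} [Field F] [CommRing S] [Algebra F S] [Module.Finite F S]
    [IsReduced S]
    (x : S) (hx : ∀ φ : S →ₐ[F] AlgebraicClosure F, φ x = 0) : x = 0 := by
  have : IsArtinianRing S := IsArtinianRing.of_finite F S
  apply IsNilpotent.eq_zero
  rw [← mem_nilradical, nilradical_eq_sInf, Submodule.mem_sInf]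
  intro (M : Ideal S) hM
  have hM : M.IsPrime := hM
  have : M.IsMaximal := inferInstance
  let _ := Ideal.Quotient.field M
  let φ : (S ⧸ M) →ₐ[F] AlgebraicClosure F := IsAlgClosed.lift
  have := hx (φ.comp (Ideal.Quotient.mkₐ F M))
  simp only [AlgHom.comp_apply, map_eq_zero] at this
  exact Ideal.Quotient.eq_zero_iff_mem.1 this

theorem aux_sep {F R : Type*} [Field F] [CommRing R] [Algebra F R] [Module.Finite F R]
    (Q : Polynomial R) (hQ : Q.Monic)
    (hsep : ∀ ρ : R →ₐ[F] AlgebraicClosure F, (Q.map ρ.toRingHom).Separable) :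
    Q.Separable := by
  have : Module.Finite R (AdjoinRoot Q) := hQ.finite_adjoinRoot
  have : Module.Finite F (AdjoinRoot Q) := Module.Finite.trans R _
  have hu : IsUnit (AdjoinRoot.mk Q (Polynomial.derivative Q)) := by
    apply aux_unit_s10 (F := F)
    intro φ h0
    let ρ : R →ₐ[F] AlgebraicClosure F := φ.comp (IsScalarTower.toAlgHom F R (AdjoinRoot Q))
    have hev : ∀ P : Polynomial R, φ (AdjoinRoot.mk Q P) =
        (P.map ρ.toRingHom).eval (φ (AdjoinRoot.root Q)) := by
      intro P
      induction P using Polynomial.induction_on' with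
      | add p q hp hq => simp [hp, hq]
      | monomial n a =>
        rw [Polynomial.map_monomial, Polynomial.eval_monomial, ← Polynomial.C_mul_X_pow_eq_monomial]
        simp [ρ, AdjoinRoot.algebraMap_eq]
    have h1 := hev Q
    rw [AdjoinRoot.mk_self, map_zero] at h1
    rw [hev, ← Polynomial.derivative_map] at h0
    exact (hsep ρ).eval₂_derivative_ne_zero (RingHom.id _) (by simpa using h1.symm) (by simpa using h0)
  obtain ⟨b, hb⟩ := hu.exists_right_inv
  obtain ⟨b, rfl⟩ := AdjoinRoot.mk_surjective b
  rw [← map_mul, ← map_one (AdjoinRoot.mk Q), AdjoinRoot.mk_eq_mk] at hb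
  obtain ⟨c, hc⟩ := hb
  exact ⟨-c, b, by linear_combination hc⟩

theorem aux_lift {R T : Type*} [CommRing R] [CommRing T] [Algebra R T] (Q : Polynomial R) (x : T)
    (hx : Polynomial.aeval x Q = 0) : ∃ g : AdjoinRoot Q →ₐ[R] T, g (AdjoinRoot.root Q) = x :=
  ⟨AdjoinRoot.liftAlgHom Q (Algebra.ofId R T) x hx, AdjoinRoot.lift_root hx⟩

theorem aux_etale {R : Type*} [CommRing R] (Q : Polynomial R) (hQ : Q.Monic) (hs : Q.Separable) :
    Algebra.Etale R (AdjoinRoot Q) := by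
  obtain ⟨a, b, hab⟩ := hs
  let P : StandardEtalePair R := ⟨Q, hQ, 1, b, a, 0, by linear_combination hab⟩
  have hm : P.HasMap (AdjoinRoot.root Q) := ⟨by simp [P], by simp [P]⟩
  obtain ⟨g, hg⟩ := aux_lift Q P.X P.hasMap_X.1
  let e : P.Ring ≃ₐ[R] AdjoinRoot Q :=
    AlgEquiv.ofAlgHom (P.lift (AdjoinRoot.root Q) hm) g
      (by
        apply AdjoinRoot.algHom_ext
        rw [AlgHom.comp_apply, hg, P.lift_X _ hm]
        rfl)
      (by
        apply P.hom_ext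
        rw [AlgHom.comp_apply, P.lift_X _ hm, hg]
        rfl)
  exact Algebra.Etale.of_equiv e

theorem aux_back {F R : Type*} [Field F] [CommRing R] [Nontrivial R] [Algebra F R] [Module.Finite F R]
    [IsReduced R] {m : ℕ} (A B s : Matrix (Fin m) (Fin m) R) (t n d : R)
    (hA : A * A = t • A - n • 1) (hB : B * B = t • B - n • 1) (hd : d * (t ^ 2 - 4 * n) = 1)
    (hS : s = d • ((A - B) * (A - B))) (Q : Polynomial R) (hQm : Q.Monic) (hQ : Q ^ 2 = s.charpoly)
    (H : ∀ ρ : R →ₐ[F] AlgebraicClosure F,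
        (Q.map ρ.toRingHom).Separable ∧ Polynomial.eval 0 (Q.map ρ.toRingHom) ≠ 0) :
    IsUnit s ∧
      Algebra.Etale R (Algebra.adjoin R {s}) ∧
      Module.Free R (Algebra.adjoin R {s}) ∧
      Module.finrank R (Algebra.adjoin R {s}) = Q.natDegree := by
  have hu : IsUnit (Q.coeff 0) := by
    apply aux_unit_s10 (F := F)
    intro ρ
    have := (H ρ).2
    rw [← Polynomial.coeff_zero_eq_eval_zero, Polynomial.coeff_map] at this
    exact this
  have hsep : Q.Separable := aux_sep (F := F) Q hQm fun ρ => (H ρ).1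
  have hev : ∀ (ρ : R →ₐ[F] AlgebraicClosure F) (P : Polynomial R),
      Polynomial.aeval (s.map ρ) (P.map ρ.toRingHom) = (Polynomial.aeval s P).map ρ := by
    intro ρ P
    induction P using Polynomial.induction_on' with
    | add p q hp hq => 
      simp only [Polynomial.map_add, map_add, hp, hq]
      rw [Matrix.map_add ρ (map_add ρ)]
    | monomial i a =>
      have h1 : (s.map ρ) ^ i = (s ^ i).map ρ := (map_pow ρ.mapMatrix s i).symm
      rw [Polynomial.map_monomial, Polynomial.aeval_monomial, Polynomial.aeval_monomial, h1,
        Algebra.algebraMap_eq_smul_one, Algebra.algebraMap_eq_smul_one, smul_mul_assoc, one_mul,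
        smul_mul_assoc, one_mul]
      ext i j
      simp
  have hch : ∀ (ρ : R →ₐ[F] AlgebraicClosure F),
      (Q.map ρ.toRingHom) ^ 2 = (s.map ρ).charpoly := by
    intro ρ
    rw [← Polynomial.map_pow, hQ]
    exact (Matrix.charpoly_map s ρ.toRingHom).symm
  have hquad : ∀ (ρ : R →ₐ[F] AlgebraicClosure F) (X : Matrix (Fin m) (Fin m) R),
      X * X = t • X - n • 1 →
      X.map ρ * X.map ρ = ρ t • X.map ρ - ρ n • 1 := by
    intro ρ X hX
    have := congrArg ρ.mapMatrix hX
    rw [map_mul, map_sub] at this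
    simp only [AlgHom.mapMatrix_apply] at this
    rw [this]
    ext i j
    by_cases hij : i = j <;> simp [hij, Matrix.one_apply]
  have hQs : Polynomial.aeval s Q = 0 := by
    ext i j
    apply aux_zero (F := F)
    intro ρ
    have := aux_matrix (A.map ρ) (B.map ρ) (s.map ρ) (ρ t) (ρ n) (ρ d) (hquad ρ A hA) (hquad ρ B hB)
      (by
        have := congrArg ρ hd
        simp only [map_mul, map_sub, map_pow, map_one, map_ofNat] at this
        exact right_ne_zero_of_mul_eq_one this)
      (by
        have h1 : ρ.mapMatrix ((A - B) * (A - B)) =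
            (A.map ρ - B.map ρ) * (A.map ρ - B.map ρ) := by
          rw [map_mul, map_sub]; rfl
        rw [← h1, hS]
        ext i j
        rw [AlgHom.mapMatrix_apply, Matrix.map_apply, Matrix.smul_apply, Matrix.smul_apply,
          Matrix.map_apply, smul_eq_mul, smul_eq_mul, map_mul]) _ (hch ρ) (H ρ).1
    rw [hev] at this
    exact congrFun (congrFun this i) j
  have hinj : ∀ P : Polynomial R, Polynomial.aeval s P = 0 → Q ∣ P := by
    intro P hP
    rw [← Polynomial.modByMonic_eq_zero_iff_dvd hQm]
    have hlt := Polynomial.degree_modByMonic_lt P hQm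
    have hP' : Polynomial.aeval s (P %ₘ Q) = 0 := by
      have := congrArg (Polynomial.aeval s) (Polynomial.modByMonic_add_div P Q)
      rw [map_add, map_mul, hQs, zero_mul, add_zero, hP] at this
      exact this
    ext i
    rw [Polynomial.coeff_zero]
    apply aux_zero (F := F)
    intro ρ
    have h0 := hev ρ (P %ₘ Q)
    rw [hP'] at h0
    have hz : (0 : Matrix (Fin m) (Fin m) R).map ρ = 0 := by ext; simp
    have hdvd := aux_dvd (s.map ρ) (Q.map ρ.toRingHom) _ (hch ρ) (H ρ).1 (h0.trans hz)
    have hzero := Polynomial.eq_zero_of_dvd_of_degree_lt hdvd (by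
      rw [hQm.degree_map]
      exact lt_of_le_of_lt Polynomial.degree_map_le hlt)
    have := congrArg (fun p => Polynomial.coeff p i) hzero
    simpa using this
  let x : Algebra.adjoin R {s} := ⟨s, Algebra.self_mem_adjoin_singleton R s⟩
  have hxval : ∀ P : Polynomial R, ((Polynomial.aeval x P : Algebra.adjoin R {s}) :
      Matrix (Fin m) (Fin m) R) = Polynomial.aeval s P := fun P =>
    (Polynomial.aeval_algHom_apply (Algebra.adjoin R {s}).val x P).symm
  let f : AdjoinRoot Q →ₐ[R] Algebra.adjoin R {s} :=
    AdjoinRoot.liftAlgHom Q (Algebra.ofId R _) x (Subtype.ext ((hxval Q).trans hQs))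
  have hf : ∀ P, f (AdjoinRoot.mk Q P) = Polynomial.aeval x P := fun P => by
    simp [f]; rfl
  have hbij : Function.Bijective f := by
    constructor
    · rw [injective_iff_map_eq_zero]
      intro z hz
      obtain ⟨P, rfl⟩ := AdjoinRoot.mk_surjective z
      rw [hf] at hz
      rw [AdjoinRoot.mk_eq_zero]
      apply hinj
      rw [← hxval, hz]; rfl
    · rintro ⟨z, hz⟩
      have hz' := hz
      rw [Algebra.adjoin_singleton_eq_range_aeval] at hz'
      obtain ⟨P, hP⟩ := hz'
      exact ⟨AdjoinRoot.mk Q P, Subtype.ext (by rw [hf, hxval]; exact hP)⟩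
  let e : AdjoinRoot Q ≃ₐ[R] Algebra.adjoin R {s} := AlgEquiv.ofBijective f hbij
  have hfree := hQm.free_adjoinRoot
  refine ⟨?_, ?_, ?_, ?_⟩
  · rw [Matrix.isUnit_iff_isUnit_det, Matrix.det_eq_sign_charpoly_coeff, ← hQ,
      Polynomial.coeff_zero_eq_eval_zero, Polynomial.eval_pow, ← Polynomial.coeff_zero_eq_eval_zero]
    exact ((isUnit_one.neg).pow _).mul (hu.pow 2)
  · have := aux_etale Q hQm hsep
    exact Algebra.Etale.of_equiv e
  · exact Module.Free.of_equiv e.toLinearEquiv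
  · rw [← e.toLinearEquiv.finrank_eq, (AdjoinRoot.powerBasis' hQm).finrank, AdjoinRoot.powerBasis'_dim]

theorem aux_fwd {F R : Type*} [Field F] [CommRing R] [Nontrivial R] [Algebra F R] 
    {m : ℕ} (s : Matrix (Fin m) (Fin m) R) (Q : Polynomial R) (hQm : Q.Monic) (hQ : Q ^ 2 = s.charpoly)
    (hu : IsUnit s) (het : Algebra.Etale R (Algebra.adjoin R {s}))
    (hfree : Module.Free R (Algebra.adjoin R {s}))
    (hrank : Module.finrank R (Algebra.adjoin R {s}) = Q.natDegree)
    (ρ : R →ₐ[F] AlgebraicClosure F) :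
    (Q.map ρ.toRingHom).Separable ∧ Polynomial.eval 0 (Q.map ρ.toRingHom) ≠ 0 := by
  constructor
  · let T := Algebra.adjoin R {s}
    let x : T := ⟨s, Algebra.self_mem_adjoin_singleton R s⟩
    have hxval : ∀ P : Polynomial R, ((Polynomial.aeval x P : T) :
        Matrix (Fin m) (Fin m) R) = Polynomial.aeval s P := fun P =>
      (Polynomial.aeval_algHom_apply (Algebra.adjoin R {s}).val x P).symm
    have hsurj : ∀ z : T, ∃ P : Polynomial R, Polynomial.aeval x P = z := by
      rintro ⟨z, hz⟩
      have hz' : z ∈ Algebra.adjoin R {s} := hz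
      rw [Algebra.adjoin_singleton_eq_range_aeval] at hz'
      obtain ⟨P, hP⟩ := hz'
      exact ⟨P, Subtype.ext (by rw [hxval]; exact hP)⟩
    have hQ2 : (Polynomial.aeval x Q) ^ 2 = 0 := by
      apply Subtype.ext
      rw [← map_pow, hxval, hQ]
      exact Matrix.aeval_self_charpoly s
    let k := AlgebraicClosure F
    let _ : Algebra R k := ρ.toRingHom.toAlgebra
    let C := k ⊗[R] T
    have : Module.Finite R T := by
      have : IsIntegral R s := Matrix.isIntegral s
      exact Module.Finite.iff_fg.2 this.fg_adjoin_singleton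
    have : Algebra.Etale k C := inferInstance
    have hred : IsReduced C := Algebra.FormallyUnramified.isReduced_of_field k C
    have hdimC : Module.finrank k C = Q.natDegree := by
      rw [← hrank]; exact Module.finrank_baseChange
    let x' : C := 1 ⊗ₜ x
    have hx' : ∀ P : Polynomial R, Polynomial.aeval x' (P.map ρ.toRingHom) =
        (1 : k) ⊗ₜ[R] (Polynomial.aeval x P) := by
      intro P
      have h1 := Polynomial.aeval_map_algebraMap k x' P
      have h2 := Polynomial.aeval_algHom_apply
        (Algebra.TensorProduct.includeRight : T →ₐ[R] C) x P
      exact h1.trans h2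
    have hQx' : Polynomial.aeval x' (Q.map ρ.toRingHom) = 0 := by
      have : (Polynomial.aeval x' (Q.map ρ.toRingHom)) ^ 2 = 0 := by
        rw [hx', Algebra.TensorProduct.tmul_pow, hQ2, TensorProduct.tmul_zero]
      exact pow_eq_zero_iff two_ne_zero |>.1 this
    have hint : IsIntegral k x' := ⟨_, hQm.map _, hQx'⟩
    have htop : Algebra.adjoin k {x'} = ⊤ := by
      rw [eq_top_iff]
      rintro z -
      induction z using TensorProduct.induction_on with
      | zero => exact zero_mem _
      | add a b ha hb => exact add_mem ha hb
      | tmul a b =>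
        obtain ⟨P, rfl⟩ := hsurj b
        have : a ⊗ₜ[R] (Polynomial.aeval x P) = a • ((1 : k) ⊗ₜ[R] (Polynomial.aeval x P)) := by
          rw [TensorProduct.smul_tmul', smul_eq_mul, mul_one]
        rw [this, ← hx']
        exact Subalgebra.smul_mem _ (Polynomial.aeval_mem_adjoin_singleton k x') a
    have hmin : (minpoly k x').natDegree = Q.natDegree := by
      rw [← hdimC, ← Algebra.adjoin.powerBasis_dim hint, ← PowerBasis.finrank, htop]
      exact (Subalgebra.topEquiv (R := k) (A := C)).toLinearEquiv.finrank_eq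
    have heq : Q.map ρ.toRingHom = minpoly k x' := by
      refine (Polynomial.eq_of_monic_of_dvd_of_natDegree_le (minpoly.monic hint) (hQm.map _)
        (minpoly.dvd k x' hQx') ?_)
      rw [hmin, hQm.natDegree_map]
    rw [heq, PerfectField.separable_iff_squarefree]
    exact (isRadical_iff_squarefree_of_ne_zero (minpoly.ne_zero hint)).1 (minpoly.isRadical k x')
  · rw [← Polynomial.coeff_zero_eq_eval_zero, Polynomial.coeff_map]
    have hc : IsUnit (Q.coeff 0) := by
      rw [Matrix.isUnit_iff_isUnit_det, Matrix.det_eq_sign_charpoly_coeff, ← hQ,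
        Polynomial.coeff_zero_eq_eval_zero, Polynomial.eval_pow,
        ← Polynomial.coeff_zero_eq_eval_zero] at hu
      exact (isUnit_pow_iff two_ne_zero).1 (isUnit_of_mul_isUnit_right hu)
    exact (hc.map ρ.toRingHom).ne_zero

/-- Characterization of regular semisimplicity in terms of the invariant
polynomial: `s` is a unit with `K₃[s]` étale of rank `h` over `K₃` if and only
if, for every `F`-algebra map `ρ : K₃ → F̄`, the polynomial `Q^ρ` is separable
with nonzero constant term. -/
theorem regular_semisimple_iff_invariant_separable
    (F : Type u) [Field F] (K₁ K₂ : Type u)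
    [CommRing K₁] [CommRing K₂] [Algebra F K₁] [Algebra F K₂]
    [Algebra.Etale F K₁] [Algebra.Etale F K₂]
    (hdim₁ : Module.finrank F K₁ = 2) (hdim₂ : Module.finrank F K₂ = 2)
    (σ₁ : K₁ ≃ₐ[F] K₁) (σ₂ : K₂ ≃ₐ[F] K₂)
    (hσ₁ : ∀ x : K₁, σ₁ (σ₁ x) = x) (hσ₂ : ∀ x : K₂, σ₂ (σ₂ x) = x)
    (hσ₁fix : ∀ x : K₁, σ₁ x = x ↔ ∃ a : F, algebraMap F K₁ a = x)
    (hσ₂fix : ∀ x : K₂, σ₂ x = x ↔ ∃ a : F, algebraMap F K₂ a = x)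
    (h : ℕ) (hh : 0 < h)
    (Φ₁ : K₁ →ₐ[F] Matrix (Fin (2*h)) (Fin (2*h)) F)
    (Φ₂ : K₂ →ₐ[F] Matrix (Fin (2*h)) (Fin (2*h)) F)
    (Φt₁ Φt₂ : (K₁ ⊗[F] K₂) →ₐ[F] Matrix (Fin (2*h)) (Fin (2*h)) (K3 σ₁ σ₂))
    (hΦt₁ : ∀ x : K₁, Φt₁ (x ⊗ₜ[F] (1 : K₂)) = (Φ₁ x).map (algebraMap F (K3 σ₁ σ₂)))
    (hΦt₂ : ∀ x : K₂, Φt₂ ((1 : K₁) ⊗ₜ[F] x) = (Φ₂ x).map (algebraMap F (K3 σ₁ σ₂)))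
    (hΦt₁c : ∀ c : K3 σ₁ σ₂,
      Φt₁ (c : K₁ ⊗[F] K₂) = algebraMap (K3 σ₁ σ₂) (Matrix (Fin (2*h)) (Fin (2*h)) (K3 σ₁ σ₂)) c)
    (hΦt₂c : ∀ c : K3 σ₁ σ₂,
      Φt₂ (c : K₁ ⊗[F] K₂) = algebraMap (K3 σ₁ σ₂) (Matrix (Fin (2*h)) (Fin (2*h)) (K3 σ₁ σ₂)) c)
    -- a `K₃`-generator `y` of `K`
    (y : K₁ ⊗[F] K₂)
    (hygen : ∀ k : K₁ ⊗[F] K₂, ∃ a b : K3 σ₁ σ₂, k = (a : K₁ ⊗[F] K₂) + (b : K₁ ⊗[F] K₂) * y)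
    (hyunit : IsUnit (y - tau3 σ₁ σ₂ y))
    -- a monic square root `Q` of the characteristic polynomial of `s`
    (Q : Polynomial (K3 σ₁ σ₂)) (hQmonic : Q.Monic) (hQdeg : Q.natDegree = h)
    (hQ : Q ^ 2 = Matrix.charpoly
      (Ring.inverse (Φt₁ ((y - tau3 σ₁ σ₂ y) ^ 2)) * (Φt₁ y - Φt₂ (tau3 σ₁ σ₂ y)) ^ 2)) :
    let s := Ring.inverse (Φt₁ ((y - tau3 σ₁ σ₂ y) ^ 2)) * (Φt₁ y - Φt₂ (tau3 σ₁ σ₂ y)) ^ 2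
    (IsUnit s ∧
      Algebra.Etale (K3 σ₁ σ₂) (Algebra.adjoin (K3 σ₁ σ₂) {s}) ∧
      Module.Free (K3 σ₁ σ₂) (Algebra.adjoin (K3 σ₁ σ₂) {s}) ∧
      Module.finrank (K3 σ₁ σ₂) (Algebra.adjoin (K3 σ₁ σ₂) {s}) = h)
    ↔ (∀ ρ : K3 σ₁ σ₂ →ₐ[F] AlgebraicClosure F,
        (Q.map ρ.toRingHom).Separable ∧ Polynomial.eval 0 (Q.map ρ.toRingHom) ≠ 0) := by
  classical
  have fin₁ : Module.Finite F K₁ := Module.finite_of_finrank_pos (by omega)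
  have fin₂ : Module.Finite F K₂ := Module.finite_of_finrank_pos (by omega)
  have finK : Module.Finite F (K₁ ⊗[F] K₂) := inferInstance
  have et : Algebra.Etale F (K₁ ⊗[F] K₂) := Algebra.Etale.comp F K₁ (K₁ ⊗[F] K₂)
  have redK : IsReduced (K₁ ⊗[F] K₂) := Algebra.FormallyUnramified.isReduced_of_field F _
  have fin₃ : Module.Finite F (K3 σ₁ σ₂) :=
    FiniteDimensional.finiteDimensional_submodule (Subalgebra.toSubmodule (K3 σ₁ σ₂))
  have red₃ : IsReduced (K3 σ₁ σ₂) :=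
    isReduced_of_injective (K3 σ₁ σ₂).val Subtype.val_injective
  have ntK : Nontrivial (K₁ ⊗[F] K₂) := by
    apply Module.nontrivial_of_finrank_pos (R := F)
    rw [Module.finrank_tensorProduct, hdim₁, hdim₂]; norm_num
  have nt₃ : Nontrivial (K3 σ₁ σ₂) := inferInstance
  have hmem : ∀ x, x ∈ K3 σ₁ σ₂ ↔ tau3 σ₁ σ₂ x = x := fun x => Iff.rfl
  have hinv : ∀ x, tau3 σ₁ σ₂ (tau3 σ₁ σ₂ x) = x := by
    intro x
    induction x using TensorProduct.induction_on with
    | zero => simp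
    | add a b ha hb => rw [map_add, map_add, ha, hb]
    | tmul a b => simp [tau3, hσ₁, hσ₂]
  let t : K3 σ₁ σ₂ := ⟨y + tau3 σ₁ σ₂ y, by rw [hmem, map_add, hinv, add_comm]⟩
  let n : K3 σ₁ σ₂ := ⟨y * tau3 σ₁ σ₂ y, by rw [hmem, map_mul, hinv, mul_comm]⟩
  have hc : ((y - tau3 σ₁ σ₂ y) ^ 2 : K₁ ⊗[F] K₂) = ((t ^ 2 - 4 * n : K3 σ₁ σ₂) : K₁ ⊗[F] K₂) := by
    have h4 : ((4 : K3 σ₁ σ₂) : K₁ ⊗[F] K₂) = 4 := map_ofNat (K3 σ₁ σ₂).val 4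
    push_cast
    rw [h4]
    simp only [t, n]
    ring
  obtain ⟨z, hz⟩ := (hyunit.pow 2).exists_right_inv
  have hzmem : z ∈ K3 σ₁ σ₂ := by
    rw [hmem]
    have h1 := congrArg (tau3 σ₁ σ₂) hz
    rw [map_mul, map_one, map_pow, map_sub, hinv] at h1
    apply (hyunit.pow 2).mul_left_cancel
    rw [hz, ← h1]; ring
  let d : K3 σ₁ σ₂ := ⟨z, hzmem⟩
  have hd : d * (t ^ 2 - 4 * n) = 1 := by
    apply Subtype.ext
    rw [MulMemClass.coe_mul, ← hc, mul_comm]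
    exact hz
  have hy1 : y * y = (t : K₁ ⊗[F] K₂) * y - (n : K₁ ⊗[F] K₂) := by
    simp only [t, n]; ring
  have hy2 : tau3 σ₁ σ₂ y * tau3 σ₁ σ₂ y = (t : K₁ ⊗[F] K₂) * tau3 σ₁ σ₂ y - (n : K₁ ⊗[F] K₂) := by
    simp only [t, n]; ring
  have hA : Φt₁ y * Φt₁ y = t • Φt₁ y - n • 1 := by
    rw [← map_mul, hy1, map_sub, map_mul, hΦt₁c, hΦt₁c, Algebra.algebraMap_eq_smul_one,
      Algebra.algebraMap_eq_smul_one, smul_mul_assoc, one_mul]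
  have hB : Φt₂ (tau3 σ₁ σ₂ y) * Φt₂ (tau3 σ₁ σ₂ y) = t • Φt₂ (tau3 σ₁ σ₂ y) - n • 1 := by
    rw [← map_mul, hy2, map_sub, map_mul, hΦt₂c, hΦt₂c, Algebra.algebraMap_eq_smul_one,
      Algebra.algebraMap_eq_smul_one, smul_mul_assoc, one_mul]
  have hinvd : Ring.inverse (Φt₁ ((y - tau3 σ₁ σ₂ y) ^ 2)) = d • 1 := by
    rw [hc, hΦt₁c, Algebra.algebraMap_eq_smul_one]
    have e1 : ((t ^ 2 - 4 * n) • (1 : Matrix (Fin (2*h)) (Fin (2*h)) (K3 σ₁ σ₂))) *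
        (d • (1 : Matrix (Fin (2*h)) (Fin (2*h)) (K3 σ₁ σ₂))) = 1 := by
      rw [smul_mul_smul_comm, one_mul, mul_comm (t ^ 2 - 4 * n) d, hd, one_smul]
    have e2 : (d • (1 : Matrix (Fin (2*h)) (Fin (2*h)) (K3 σ₁ σ₂))) *
        ((t ^ 2 - 4 * n) • (1 : Matrix (Fin (2*h)) (Fin (2*h)) (K3 σ₁ σ₂))) = 1 := by
      rw [smul_mul_smul_comm, one_mul, hd, one_smul]
    exact Ring.inverse_unit ⟨_, _, e1, e2⟩
  intro s
  have hs : s = d • ((Φt₁ y - Φt₂ (tau3 σ₁ σ₂ y)) * (Φt₁ y - Φt₂ (tau3 σ₁ σ₂ y))) := by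
    simp only [s]
    rw [hinvd, pow_two, smul_mul_assoc, one_mul]
  have hQ' : Q ^ 2 = s.charpoly := hQ
  clear_value s
  constructor
  · rintro ⟨h1, h2, h3, h4⟩ ρ
    exact aux_fwd s Q hQmonic hQ' h1 h2 h3 (h4.trans hQdeg.symm) ρ
  · intro H
    have := aux_back (F := F) _ _ s t n d hA hB hd hs Q hQmonic hQ' H
    exact ⟨this.1, this.2.1, this.2.2.1, this.2.2.2.trans hQdeg⟩
end

section
/- Fix a K₃-generator y ∈ K and let s = ((y − τ₃(y))²)⁻¹·(Φ̃₁(y) − Φ̃₂(τ₃(y)))² ∈ C. Suppose c ∈ C is a unit with Φ̃₂(x) = c⁻¹·Φ̃₁(x)·c for all x ∈ K, and suppose c = c₊ + c₋ where c₊ ∈ C satisfies Φ̃₁(x)·c₊ = c₊·Φ̃₁(x) for all x ∈ K and c₋ ∈ C satisfies Φ̃₁(x)·c₋ = c₋·Φ̃₁(τ₃(x)) for all x ∈ K. Then c₊ − c₋ is a unit of C, and s = (c₊ + c₋)⁻¹ · c₊ · (c₊ − c₋)⁻¹ · c₊. -/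
open TensorProduct

set_option synthInstance.maxHeartbeats 1000000
set_option maxHeartbeats 2000000

universe u

theorem aux_ring {R : Type*} [Ring R] (u v p m : R) (c d : Rˣ) (hd : (d : R) = u - v)
    (hsum : (c : R) = p + m) (hup : u * p = p * u) (hvp : v * p = p * v)
    (hum : u * m = m * v) (hvm : v * m = m * u) :
    IsUnit (p - m) ∧ Ring.inverse ((d : R) ^ 2) * (u - ((c⁻¹ : Rˣ) : R) * v * c) ^ 2
      = Ring.inverse (p + m) * p * Ring.inverse (p - m) * p := by
  have hdp : (d : R) * p = p * d := by rw [hd, sub_mul, mul_sub, hup, hvp]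
  have hdm : (d : R) * m = - (m * d) := by rw [hd, sub_mul, mul_sub, hum, hvm]; abel
  have hdc : (d : R) * c = (p - m) * d := by
    rw [hsum, mul_add, hdp, hdm, sub_mul, sub_eq_add_neg]
  have he : ((d * c * d⁻¹ : Rˣ) : R) = p - m := by
    rw [Units.val_mul, Units.val_mul, hdc, Units.mul_inv_cancel_right]
  have hcd : (c : R) * d = d * (p - m) := by
    rw [hsum, add_mul, mul_sub, hdp, hdm, sub_neg_eq_add]
  refine ⟨⟨_, he⟩, ?_⟩
  have h1 : u - ((c⁻¹ : Rˣ) : R) * v * c = ((c⁻¹ : Rˣ) : R) * (p * d) := by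
    have : p * (d : R) = c * u - v * c := by
      rw [hsum, hd, add_mul, mul_add, mul_sub, hvp, hvm]; abel
    rw [this, mul_sub, Units.inv_mul_cancel_left, mul_assoc]
  have hpc : Commute ((d ^ 2 : Rˣ) : R) p := by
    have h : Commute (d : R) p := hdp
    simpa using h.pow_left 2
  have hcc : Commute (d ^ 2 : Rˣ) c := by
    apply Units.ext
    push_cast
    rw [pow_two, mul_assoc, hdc, ← mul_assoc, ← hcd, mul_assoc]
  have hinv : d * c⁻¹ = (d * c * d⁻¹)⁻¹ * d := by group
  have hinv' : ((d : R)) * ((c⁻¹ : Rˣ) : R) = (((d * c * d⁻¹)⁻¹ : Rˣ) : R) * d := by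
    rw [← Units.val_mul, hinv, Units.val_mul]
  have hce : Commute (d ^ 2 : Rˣ) (d * c * d⁻¹) := by
    have h0 : Commute (d ^ 2 : Rˣ) d := (Commute.refl d).pow_left 2
    exact (h0.mul_right hcc).mul_right h0.inv_right
  rw [← he, ← hsum, ← Units.val_pow_eq_pow_val, Ring.inverse_unit, Ring.inverse_unit,
    Ring.inverse_unit, Units.inv_mul_eq_iff_eq_mul, h1]
  generalize d * c * d⁻¹ = e at *
  have hc1 : Commute ((d ^ 2 : Rˣ) : R) ((c⁻¹ : Rˣ) : R) := hcc.inv_right.units_val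
  have he1 : Commute ((d ^ 2 : Rˣ) : R) ((e⁻¹ : Rˣ) : R) := hce.inv_right.units_val
  rw [(((hc1.mul_right hpc).mul_right he1).mul_right hpc).eq]
  push_cast
  calc _ = ((c⁻¹ : Rˣ) : R) * p * ((d : R) * ((c⁻¹ : Rˣ) : R)) * p * d := by
        rw [pow_two]; simp only [mul_assoc]
    _ = ((c⁻¹ : Rˣ) : R) * p * ((e⁻¹ : Rˣ) : R) * (d * p) * d := by
        rw [hinv']; simp only [mul_assoc]
    _ = _ := by rw [hdp, pow_two]; simp only [mul_assoc]

/-- Alternative construction of `s`:  if `c ∈ C^×` conjugates `Φ̃₁` into `Φ̃₂`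
and `c = c₊ + c₋` is its decomposition with `c₊` commuting with the image of
`Φ̃₁` and `c₋` intertwining `Φ̃₁` with `Φ̃₁ ∘ τ₃`, then `c₊ − c₋` is a unit and
`s = (c₊ + c₋)⁻¹ · c₊ · (c₊ − c₋)⁻¹ · c₊`. -/
theorem s_from_conjugating_element
    (F : Type u) [Field F] (K₁ K₂ : Type u)
    [CommRing K₁] [CommRing K₂] [Algebra F K₁] [Algebra F K₂]
    [Algebra.Etale F K₁] [Algebra.Etale F K₂]
    (hdim₁ : Module.finrank F K₁ = 2) (hdim₂ : Module.finrank F K₂ = 2)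
    (σ₁ : K₁ ≃ₐ[F] K₁) (σ₂ : K₂ ≃ₐ[F] K₂)
    (hσ₁ : ∀ x : K₁, σ₁ (σ₁ x) = x) (hσ₂ : ∀ x : K₂, σ₂ (σ₂ x) = x)
    (hσ₁fix : ∀ x : K₁, σ₁ x = x ↔ ∃ a : F, algebraMap F K₁ a = x)
    (hσ₂fix : ∀ x : K₂, σ₂ x = x ↔ ∃ a : F, algebraMap F K₂ a = x)
    (h : ℕ) (hh : 0 < h)
    (B : Type u) [Ring B] [Algebra F B] [FiniteDimensional F B]
    [Algebra.IsCentral F B] [IsSimpleRing B]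
    (hB : Module.finrank F B = 4 * h ^ 2)
    (Φ₁ : K₁ →ₐ[F] B) (Φ₂ : K₂ →ₐ[F] B)
    (Φt₁ Φt₂ : (K₁ ⊗[F] K₂) →ₐ[F] B ⊗[F] (K3 σ₁ σ₂))
    (hΦt₁ : ∀ x : K₁, Φt₁ (x ⊗ₜ[F] (1 : K₂)) = Φ₁ x ⊗ₜ[F] (1 : K3 σ₁ σ₂))
    (hΦt₂ : ∀ x : K₂, Φt₂ ((1 : K₁) ⊗ₜ[F] x) = Φ₂ x ⊗ₜ[F] (1 : K3 σ₁ σ₂))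
    (hΦt₁c : ∀ c : K3 σ₁ σ₂, Φt₁ (c : K₁ ⊗[F] K₂) = (1 : B) ⊗ₜ[F] c)
    (hΦt₂c : ∀ c : K3 σ₁ σ₂, Φt₂ (c : K₁ ⊗[F] K₂) = (1 : B) ⊗ₜ[F] c)
    -- a `K₃`-generator `y` of `K`
    (y : K₁ ⊗[F] K₂)
    (hygen : ∀ k : K₁ ⊗[F] K₂, ∃ a b : K3 σ₁ σ₂, k = (a : K₁ ⊗[F] K₂) + (b : K₁ ⊗[F] K₂) * y)
    (hyunit : IsUnit (y - tau3 σ₁ σ₂ y))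
    -- a unit `c` conjugating `Φ̃₁` into `Φ̃₂`, with its decomposition `c = c₊ + c₋`
    (c : (B ⊗[F] (K3 σ₁ σ₂))ˣ)
    (hc : ∀ x : K₁ ⊗[F] K₂, Φt₂ x = ((c⁻¹ : _ˣ) : B ⊗[F] (K3 σ₁ σ₂)) * Φt₁ x * (c : B ⊗[F] (K3 σ₁ σ₂)))
    (cplus cminus : B ⊗[F] (K3 σ₁ σ₂))
    (hsum : (c : B ⊗[F] (K3 σ₁ σ₂)) = cplus + cminus)
    (hplus : ∀ x : K₁ ⊗[F] K₂, Φt₁ x * cplus = cplus * Φt₁ x)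
    (hminus : ∀ x : K₁ ⊗[F] K₂, Φt₁ x * cminus = cminus * Φt₁ (tau3 σ₁ σ₂ x)) :
    IsUnit (cplus - cminus) ∧
    Ring.inverse (Φt₁ ((y - tau3 σ₁ σ₂ y) ^ 2)) * (Φt₁ y - Φt₂ (tau3 σ₁ σ₂ y)) ^ 2
      = Ring.inverse (cplus + cminus) * cplus * Ring.inverse (cplus - cminus) * cplus := by
  have htt : ∀ x, tau3 σ₁ σ₂ (tau3 σ₁ σ₂ x) = x := by
    intro x
    induction x using TensorProduct.induction_on with
    | zero => simp
    | tmul a b => simp [tau3, hσ₁, hσ₂]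
    | add a b ha hb => rw [map_add, map_add, ha, hb]
  obtain ⟨d, hd⟩ := hyunit.map Φt₁
  have hvm := hminus (tau3 σ₁ σ₂ y)
  rw [htt] at hvm
  rw [hc, map_pow, ← hd]
  exact aux_ring _ _ cplus cminus c d (by rw [hd, map_sub]) hsum (hplus _) (hplus _)
    (hminus _) hvm
end
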